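/- arXiv:0801.2525 — 7 statements merged into one kernel-verified Lean document; each statement's English description precedes it below -/
import Mathlib

section
/- Let G(I,P;E) be an Assur graph with |I| ≥ 2 (so G does not consist of a single inner vertex of degree 2). Fix a realization p placing the pins at points of ℝ² with at least two distinct locations and placing the inner vertices at points whose 2|I| coordinates are algebraically independent over the field generated over ℚ by the coordinates of the pins. Then for every inner vertex u ∈ I, the pinned rigidity matrix of the pinned graph obtained from G by deleting u and all edges incident to u has a kernel vector m : I ∖ {u} → ℝ² with m(v) ≠ 0 for every remaining inner vertex v; that is, deleting any inner vertex results in an infinitesimal motion of all remaining inner vertices. -/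
/-- The two-element set of endpoints of an edge (an unordered pair of vertices). -/
def sym2Verts {V : Type*} [DecidableEq V] (e : Sym2 V) : Finset V :=
  Sym2.lift ⟨fun a b => {a, b}, fun a b => Finset.pair_comm a b⟩ e

/-- The set `V(F)` of endpoints of the edges of a finite edge set `F`. -/
def edgeVerts {V : Type*} [DecidableEq V] (F : Finset (Sym2 V)) : Finset V :=
  F.sup sym2Verts

/-- A pinned graph `G(I,P;E)`: disjoint finite sets `I` of inner vertices and `P` of
pinned vertices, and a set `E` of edges (with two distinct endpoints), each having all
endpoints in `I ∪ P` and at least one endpoint in `I`. -/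
structure IsPinnedGraph {V : Type*} [DecidableEq V]
    (I P : Finset V) (E : Finset (Sym2 V)) : Prop where
  disj : Disjoint I P
  not_diag : ∀ e ∈ E, ¬ e.IsDiag
  endpoints : ∀ e ∈ E, sym2Verts e ⊆ I ∪ P
  inner : ∀ e ∈ E, (sym2Verts e ∩ I).Nonempty

/-- The Pinned Framework Conditions for a pinned graph `G(I,P;E)`: `|E| = 2|I|`, and
every nonempty `E' ⊆ E`, with inner endpoint set `I'` and pinned endpoint set `P'`,
satisfies `|E'| ≤ 2|I'|` if `|P'| ≥ 2`, `|E'| ≤ 2|I'| - 1` if `|P'| = 1`, and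
`|E'| ≤ 2|I'| - 3` if `P' = ∅`. -/
def PinnedConditions {V : Type*} [DecidableEq V]
    (I P : Finset V) (E : Finset (Sym2 V)) : Prop :=
  E.card = 2 * I.card ∧
  ∀ E' ⊆ E, E'.Nonempty →
    (2 ≤ (edgeVerts E' ∩ P).card → E'.card ≤ 2 * (edgeVerts E' ∩ I).card) ∧
    ((edgeVerts E' ∩ P).card = 1 → E'.card ≤ 2 * (edgeVerts E' ∩ I).card - 1) ∧
    (edgeVerts E' ∩ P = ∅ → E'.card ≤ 2 * (edgeVerts E' ∩ I).card - 3)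

/-- The row of the pinned rigidity matrix corresponding to an edge `{i,j}`: the entry at
an inner vertex `i` is `p i - p j`, the entry at an inner vertex `j` is `p j - p i`, and
all other entries are `0` (pinned vertices contribute no columns). -/
def pinnedRow {V : Type*} [DecidableEq V] (p : V → ℝ × ℝ) (I : Finset V)
    (e : Sym2 V) : V → ℝ × ℝ :=
  Sym2.lift ⟨fun i j v => if v ∈ I then
      (if v = i then p i - p j else 0) + (if v = j then p j - p i else 0) else 0,
    fun i j => funext fun v => by by_cases h : v ∈ I <;> simp [h, add_comm]⟩ e

/-- A realization `p` of a pinned graph is pinned isostatic if the rows of the pinned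
rigidity matrix indexed by `E` are linearly independent and their span has rank `2|I|`. -/
def PinnedIsostatic {V : Type*} [DecidableEq V] (I : Finset V) (E : Finset (Sym2 V))
    (p : V → ℝ × ℝ) : Prop :=
  LinearIndependent ℝ (fun e : E => pinnedRow p I e.1) ∧
  Module.finrank ℝ (Submodule.span ℝ (Set.range (fun e : E => pinnedRow p I e.1)))
    = 2 * I.card


/-- The edge set of the pinned subgraph induced by inner vertices `I'` and pinned
vertices `P'`: the edges with both endpoints in `I' ∪ P'` and at least one endpoint
in `I'`. -/
def inducedEdges {V : Type*} [DecidableEq V] (I' P' : Finset V)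
    (E : Finset (Sym2 V)) : Finset (Sym2 V) :=
  E.filter (fun e => sym2Verts e ⊆ I' ∪ P' ∧ (sym2Verts e ∩ I').Nonempty)

/-- Minimality of a pinned graph `G(I,P;E)`: every proper subset of vertices
`I' ∪ P' ⊊ I ∪ P` (with `I' ⊆ I`, `P' ⊆ P`) induces a pinned subgraph with
`|E'| ≤ 2|I'| - 1` edges. -/
def IsMinimalPinned {V : Type*} [DecidableEq V] (I P : Finset V)
    (E : Finset (Sym2 V)) : Prop :=
  ∀ I' ⊆ I, ∀ P' ⊆ P, I' ∪ P' ⊂ I ∪ P →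
    (inducedEdges I' P' E).card ≤ 2 * I'.card - 1

/-- The set of coordinates of the pinned vertices under a realization `p`. -/
def pinCoords {V : Type*} (P : Finset V) (p : V → ℝ × ℝ) : Set ℝ :=
  {x : ℝ | ∃ v ∈ P, (p v).1 = x ∨ (p v).2 = x}

/-- The inner vertices are placed generically over the pins: their `2|I|` coordinates are
algebraically independent over the field generated over `ℚ` by the pin coordinates. -/
def GenericOverPins {V : Type*} (I P : Finset V) (p : V → ℝ × ℝ) : Prop :=
  AlgebraicIndependent (IntermediateField.adjoin ℚ (pinCoords P p))
    (fun x : { v // v ∈ I } × Fin 2 => if x.2 = 0 then (p x.1.1).1 else (p x.1.1).2)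

/-- The dot product on `ℝ²`. -/
def dot (a b : ℝ × ℝ) : ℝ := a.1 * b.1 + a.2 * b.2

/-- `m` is a kernel vector of the pinned rigidity matrix of the pinned graph with inner
vertices `I` and edge set `E` at the realization `p`: `m` assigns a velocity to each
inner vertex (and `0` to all other vertices), so that for every edge `{i,j}` of `E` the
corresponding row annihilates `m`, i.e. `(p i - p j) ⬝ (m i - m j) = 0` (where `m` is
taken to be `0` at pinned vertices). -/
def IsKernelVector {V : Type*} [DecidableEq V] (p : V → ℝ × ℝ) (I : Finset V)
    (E : Finset (Sym2 V)) (m : V → ℝ × ℝ) : Prop :=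
  (∀ v, v ∉ I → m v = 0) ∧
  ∀ i j : V, s(i, j) ∈ E → dot (p i - p j) (m i - m j) = 0

section
set_option linter.unusedSectionVars false
set_option linter.unusedVariables false
variable {V : Type*} [DecidableEq V]

def prj (d : Bool) (y : ℝ × ℝ) : ℝ := if d then y.1 else y.2

def rvL (q : V → ℝ × ℝ) (e : Sym2 V) : (V → ℝ × ℝ) →ₗ[ℝ] ℝ where
  toFun m := Sym2.lift ⟨fun i j => dot (q i - q j) (m i - m j), fun i j => by
    simp only [dot, Prod.fst_sub, Prod.snd_sub]; ring⟩ e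
  map_add' m m' := by
    induction e with | _ i j =>
    simp only [Sym2.lift_mk, dot, Prod.fst_sub, Prod.snd_sub, Pi.add_apply, Prod.fst_add, Prod.snd_add]; ring
  map_smul' c m := by
    induction e with | _ i j =>
    simp only [Sym2.lift_mk, dot, Prod.fst_sub, Prod.snd_sub, Pi.smul_apply, Prod.smul_fst, Prod.smul_snd, smul_eq_mul, RingHom.id_apply]; ring

theorem rvL_mk (q m : V → ℝ × ℝ) (i j : V) : rvL q s(i, j) m = dot (q i - q j) (m i - m j) := rfl

def prjL (y : V × Bool) : (V → ℝ × ℝ) →ₗ[ℝ] ℝ where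
  toFun m := prj y.2 (m y.1)
  map_add' m m' := by simp only [prj, Pi.add_apply]; split_ifs <;> simp
  map_smul' c m := by simp only [prj, Pi.smul_apply]; split_ifs <;> simp

def Good (J : Finset V) (F : Finset (Sym2 V)) (T : Finset (V × Bool)) (q : V → ℝ × ℝ) : Prop :=
  ∀ (t : Sym2 V → ℝ) (s : V × Bool → ℝ), ∃ m : V → ℝ × ℝ, (∀ x ∉ J, m x = 0) ∧
    (∀ e ∈ F, rvL q e m = t e) ∧ ∀ y ∈ T, prj y.2 (m y.1) = s y

theorem surj_iff_det {m n : Type*} [Fintype m] [Fintype n] [DecidableEq m]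
    (A : Matrix m n ℝ) : (∀ y, ∃ z, A.mulVec z = y) ↔ (A * A.transpose).det ≠ 0 := by
  constructor
  · intro h hdet
    obtain ⟨y, hy0, hy⟩ := Matrix.exists_mulVec_eq_zero_iff.mpr hdet
    apply hy0
    obtain ⟨z, hz⟩ := h y
    have h1 : A.transpose.mulVec y = 0 := by
      rw [← Matrix.mulVec_mulVec] at hy
      have : dotProduct (A.transpose.mulVec y) (A.transpose.mulVec y) = 0 := by
        have h2 : dotProduct y (A.mulVec (A.transpose.mulVec y)) = 0 := by rw [hy]; simp
        rw [Matrix.dotProduct_mulVec, ← Matrix.mulVec_transpose] at h2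
        exact h2
      exact dotProduct_self_eq_zero.mp this
    have : dotProduct y y = 0 := by
      nth_rewrite 2 [← hz]
      rw [Matrix.dotProduct_mulVec, ← Matrix.mulVec_transpose, h1]; simp
    exact dotProduct_self_eq_zero.mp this
  · intro h y
    refine ⟨A.transpose.mulVec ((A * A.transpose)⁻¹.mulVec y), ?_⟩
    rw [Matrix.mulVec_mulVec, Matrix.mulVec_mulVec, Matrix.mul_nonsing_inv _ (Ne.isUnit h)]
    simp

def bas (x : V) (i : Bool) : V → ℝ × ℝ := Pi.single x (if i then (1, 0) else (0, 1))

def rigM (J : Finset V) (F : Finset (Sym2 V)) (T : Finset (V × Bool)) (q : V → ℝ × ℝ) :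
    Matrix (F ⊕ T) (J × Bool) ℝ := fun r c =>
  match r with
  | Sum.inl e => rvL q e.1 (bas c.1.1 c.2)
  | Sum.inr y => prjL y.1 (bas c.1.1 c.2)

theorem rigM_inl (J : Finset V) (F : Finset (Sym2 V)) (T : Finset (V × Bool)) (q : V → ℝ × ℝ)
    (z : J × Bool → ℝ) (e : F) :
    (rigM J F T q).mulVec z (Sum.inl e) = rvL q e.1 (∑ c, z c • bas c.1.1 c.2) := by
  rw [map_sum]
  simp only [Matrix.mulVec, dotProduct, rigM, map_smul, smul_eq_mul]
  exact Finset.sum_congr rfl fun _ _ => mul_comm _ _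

theorem rigM_inr (J : Finset V) (F : Finset (Sym2 V)) (T : Finset (V × Bool)) (q : V → ℝ × ℝ)
    (z : J × Bool → ℝ) (e : T) :
    (rigM J F T q).mulVec z (Sum.inr e) = prjL e.1 (∑ c, z c • bas c.1.1 c.2) := by
  rw [map_sum]
  simp only [Matrix.mulVec, dotProduct, rigM, map_smul, smul_eq_mul]
  exact Finset.sum_congr rfl fun _ _ => mul_comm _ _

theorem bas_expand (J : Finset V) (m : V → ℝ × ℝ) (hm : ∀ x ∉ J, m x = 0) :
    (∑ c : J × Bool, prj c.2 (m c.1.1) • bas c.1.1 c.2) = m := by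
  rw [Fintype.sum_prod_type]
  simp only [Fintype.sum_bool]
  have : ∀ x : V, prj true (m x) • bas x true + prj false (m x) • bas x false
      = Pi.single x (m x) := by
    intro x
    ext y <;> by_cases h : y = x
    all_goals first | (subst h; simp [prj, bas]) | simp [prj, bas, h]
  simp only [this]
  rw [Finset.sum_coe_sort J (fun x => (Pi.single x (m x) : V → ℝ × ℝ))]
  funext y
  rw [Finset.sum_apply]
  by_cases h : y ∈ J
  · rw [Finset.sum_eq_single y]
    · simp
    · intro b _ hb; simp [hb.symm]
    · intro h'; exact absurd h h'
  · rw [hm y h]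
    apply Finset.sum_eq_zero
    intro b hb
    have : y ≠ b := by rintro rfl; exact h hb
    simp [this]

theorem bas_supp (J : Finset V) (z : J × Bool → ℝ) (x : V) (hx : x ∉ J) :
    (∑ c, z c • bas c.1.1 c.2 : V → ℝ × ℝ) x = 0 := by
  rw [Finset.sum_apply]
  apply Finset.sum_eq_zero
  intro c _
  have : x ≠ c.1.1 := by rintro rfl; exact hx c.1.2
  simp [bas, this]

theorem good_iff (J : Finset V) (F : Finset (Sym2 V)) (T : Finset (V × Bool)) (q : V → ℝ × ℝ) :
    Good J F T q ↔ ((rigM J F T q) * (rigM J F T q).transpose).det ≠ 0 := by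
  rw [← surj_iff_det]
  constructor
  · intro h y
    obtain ⟨m, hm, h1, h2⟩ := h (fun e => if he : e ∈ F then y (Sum.inl ⟨e, he⟩) else 0)
      (fun e => if he : e ∈ T then y (Sum.inr ⟨e, he⟩) else 0)
    refine ⟨fun c => prj c.2 (m c.1.1), ?_⟩
    funext r
    cases r with
    | inl e =>
      rw [rigM_inl, bas_expand J m hm, h1 _ e.2]; simp
    | inr e =>
      rw [rigM_inr, bas_expand J m hm]
      exact (h2 _ e.2).trans (by simp)
  · intro h t s
    obtain ⟨z, hz⟩ := h (fun r => Sum.elim (fun e => t e.1) (fun e => s e.1) r)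
    refine ⟨∑ c, z c • bas c.1.1 c.2, bas_supp J z, ?_, ?_⟩
    · intro e he
      have := congrFun hz (Sum.inl ⟨e, he⟩)
      rw [rigM_inl] at this
      simpa using this
    · intro e he
      have := congrFun hz (Sum.inr ⟨e, he⟩)
      rw [rigM_inr] at this
      exact this

/-- coordinates -/
def crd (I : Finset V) (q : V → ℝ × ℝ) : { v // v ∈ I } × Fin 2 → ℝ :=
  fun x => if x.2 = 0 then (q x.1.1).1 else (q x.1.1).2

def PolyFn (I P : Finset V) (p : V → ℝ × ℝ) (f : (V → ℝ × ℝ) → ℝ) : Prop :=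
  ∃ Q : MvPolynomial ({ v // v ∈ I } × Fin 2) (IntermediateField.adjoin ℚ (pinCoords P p)),
    ∀ q : V → ℝ × ℝ, (∀ x ∉ I, q x = p x) → f q = MvPolynomial.aeval (crd I q) Q

variable {I P : Finset V} {p : V → ℝ × ℝ}

theorem PolyFn.generic (hgen : GenericOverPins I P p) {f : (V → ℝ × ℝ) → ℝ}
    (hf : PolyFn I P p f) (q : V → ℝ × ℝ) (hq : ∀ x ∉ I, q x = p x) (h : f q ≠ 0) : f p ≠ 0 := by
  obtain ⟨Q, hQ⟩ := hf
  have hQ0 : Q ≠ 0 := by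
    rintro rfl
    apply h; rw [hQ q hq]; simp
  rw [hQ p (fun _ _ => rfl)]
  intro h0
  apply hQ0
  have hg : AlgebraicIndependent (IntermediateField.adjoin ℚ (pinCoords P p)) (crd I p) := hgen
  exact (injective_iff_map_eq_zero _).mp hg Q h0

theorem PolyFn.zero : PolyFn I P p (fun _ => 0) := ⟨0, fun _ _ => by simp⟩
theorem PolyFn.one : PolyFn I P p (fun _ => 1) := ⟨1, fun _ _ => by simp⟩
theorem PolyFn.add {f g : (V → ℝ × ℝ) → ℝ} (hf : PolyFn I P p f) (hg : PolyFn I P p g) :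
    PolyFn I P p (fun q => f q + g q) := by
  obtain ⟨Q, hQ⟩ := hf
  obtain ⟨R, hR⟩ := hg
  exact ⟨Q + R, fun q hq => by simp [hQ q hq, hR q hq]⟩
theorem PolyFn.sub {f g : (V → ℝ × ℝ) → ℝ} (hf : PolyFn I P p f) (hg : PolyFn I P p g) :
    PolyFn I P p (fun q => f q - g q) := by
  obtain ⟨Q, hQ⟩ := hf
  obtain ⟨R, hR⟩ := hg
  exact ⟨Q - R, fun q hq => by simp [hQ q hq, hR q hq]⟩
theorem PolyFn.mul {f g : (V → ℝ × ℝ) → ℝ} (hf : PolyFn I P p f) (hg : PolyFn I P p g) :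
    PolyFn I P p (fun q => f q * g q) := by
  obtain ⟨Q, hQ⟩ := hf
  obtain ⟨R, hR⟩ := hg
  exact ⟨Q * R, fun q hq => by simp [hQ q hq, hR q hq]⟩

theorem PolyFn.fst (hd : Disjoint I P) {x : V} (hx : x ∈ I ∪ P) :
    PolyFn I P p (fun q => (q x).1) := by
  by_cases h : x ∈ I
  · exact ⟨MvPolynomial.X (⟨x, h⟩, 0), fun q _ => by simp [crd]⟩
  · have hP : x ∈ P := by simpa [h] using hx
    have hm : (p x).1 ∈ IntermediateField.adjoin ℚ (pinCoords P p) :=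
      IntermediateField.subset_adjoin ℚ (pinCoords P p) ⟨x, hP, Or.inl rfl⟩
    refine ⟨MvPolynomial.C ⟨(p x).1, hm⟩, ?_⟩
    intro q hq
    rw [MvPolynomial.aeval_C]
    exact congrArg (fun y : ℝ × ℝ => y.1) (hq x h)

theorem PolyFn.snd (hd : Disjoint I P) {x : V} (hx : x ∈ I ∪ P) :
    PolyFn I P p (fun q => (q x).2) := by
  by_cases h : x ∈ I
  · exact ⟨MvPolynomial.X (⟨x, h⟩, 1), fun q _ => by simp [crd]⟩
  · have hP : x ∈ P := by simpa [h] using hx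
    have hm : (p x).2 ∈ IntermediateField.adjoin ℚ (pinCoords P p) :=
      IntermediateField.subset_adjoin ℚ (pinCoords P p) ⟨x, hP, Or.inr rfl⟩
    refine ⟨MvPolynomial.C ⟨(p x).2, hm⟩, ?_⟩
    intro q hq
    rw [MvPolynomial.aeval_C]
    exact congrArg (fun y : ℝ × ℝ => y.2) (hq x h)

theorem PolyFn.gram {m n : Type*} [Fintype m] [Fintype n] [DecidableEq m]
    {A : (V → ℝ × ℝ) → Matrix m n ℝ} (hA : ∀ i j, PolyFn I P p (fun q => A q i j)) :
    PolyFn I P p (fun q => (A q * (A q).transpose).det) := by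
  choose Q hQ using hA
  refine ⟨((Matrix.of Q) * (Matrix.of Q).transpose).det, fun q hq => ?_⟩
  rw [AlgHom.map_det]
  change (A q * (A q).transpose).det = _
  congr 1
  ext i j
  simp [Matrix.mul_apply, hQ _ _ q hq]

theorem bas_polyfn (x a : V) (i : Bool) :
    PolyFn I P p (fun _ => (bas x i a).1) ∧ PolyFn I P p (fun _ => (bas x i a).2) := by
  by_cases h : a = x
  · subst h
    cases i <;> simp [bas, PolyFn.zero, PolyFn.one]
  · simp [bas, h, PolyFn.zero]

theorem good_transfer (hd : Disjoint I P) (hgen : GenericOverPins I P p)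
    (J : Finset V) (F : Finset (Sym2 V)) (T : Finset (V × Bool))
    (hF : ∀ x y, s(x, y) ∈ F → x ∈ I ∪ P ∧ y ∈ I ∪ P)
    (q : V → ℝ × ℝ) (hq : ∀ x ∉ I, q x = p x) (h : Good J F T q) : Good J F T p := by
  rw [good_iff] at h ⊢
  refine PolyFn.generic hgen (f := fun q => (rigM J F T q * (rigM J F T q).transpose).det)
    (PolyFn.gram ?_) q hq h
  rintro (⟨e, he⟩ | y) c
  · induction e with | _ i j =>
    obtain ⟨hi, hj⟩ := hF i j he
    change PolyFn I P p (fun q => rvL q s(i, j) (bas c.1.1 c.2))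
    simp only [rvL_mk, dot, Prod.fst_sub, Prod.snd_sub]
    exact PolyFn.add
      (PolyFn.mul (PolyFn.sub (PolyFn.fst hd hi) (PolyFn.fst hd hj))
        (PolyFn.sub (bas_polyfn _ _ _).1 (bas_polyfn _ _ _).1))
      (PolyFn.mul (PolyFn.sub (PolyFn.snd hd hi) (PolyFn.snd hd hj))
        (PolyFn.sub (bas_polyfn _ _ _).2 (bas_polyfn _ _ _).2))
  · change PolyFn I P p (fun _ => prj y.1.2 (bas c.1.1 c.2 y.1.1))
    unfold prj
    split_ifs
    · exact (bas_polyfn _ _ _).1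
    · exact (bas_polyfn _ _ _).2

def cr (a b : ℝ × ℝ) : ℝ := a.1 * b.2 - a.2 * b.1

theorem noncol (hd : Disjoint I P) (hgen : GenericOverPins I P p) {a b c : V}
    (ha : a ∈ I) (hb : b ∈ I) (hc : c ∈ I ∪ P) (hab : a ≠ b) (hac : a ≠ c) (hbc : b ≠ c) :
    cr (p a - p c) (p b - p c) ≠ 0 := by
  have ha' : a ∈ I ∪ P := Finset.mem_union_left _ ha
  have hb' : b ∈ I ∪ P := Finset.mem_union_left _ hb
  refine PolyFn.generic hgen (f := fun q => cr (q a - q c) (q b - q c)) ?_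
    (Function.update (Function.update p a (p c + (1, 0))) b (p c + (0, 1))) ?_ ?_
  · simp only [cr, Prod.fst_sub, Prod.snd_sub]
    exact PolyFn.sub
      (PolyFn.mul (PolyFn.sub (PolyFn.fst hd ha') (PolyFn.fst hd hc))
        (PolyFn.sub (PolyFn.snd hd hb') (PolyFn.snd hd hc)))
      (PolyFn.mul (PolyFn.sub (PolyFn.snd hd ha') (PolyFn.snd hd hc))
        (PolyFn.sub (PolyFn.fst hd hb') (PolyFn.fst hd hc)))
  · intro x hx
    have h1 : x ≠ a := by rintro rfl; exact hx ha
    have h2 : x ≠ b := by rintro rfl; exact hx hb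
    simp [h1, h2]
  · simp [cr, hab, hac.symm, hbc.symm]

theorem coord_ne (hd : Disjoint I P) (hgen : GenericOverPins I P p) {a c : V}
    (ha : a ∈ I) (hc : c ∈ I ∪ P) (hac : a ≠ c) (d : Bool) :
    prj d (p a) - prj d (p c) ≠ 0 := by
  have ha' : a ∈ I ∪ P := Finset.mem_union_left _ ha
  refine PolyFn.generic hgen (f := fun q => prj d (q a) - prj d (q c)) ?_
    (Function.update p a (p c + (1, 1))) ?_ ?_
  · unfold prj
    split_ifs
    · exact PolyFn.sub (PolyFn.fst hd ha') (PolyFn.fst hd hc)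
    · exact PolyFn.sub (PolyFn.snd hd ha') (PolyFn.snd hd hc)
  · intro x hx
    have h1 : x ≠ a := by rintro rfl; exact hx ha
    simp [h1]
  · unfold prj
    split_ifs <;> simp [hac.symm]
end
section
set_option linter.unusedSectionVars false
set_option linter.unusedVariables false
variable {V : Type*} [DecidableEq V]

theorem three_blocks {ε : Type*} [DecidableEq ε] (F : Finset ε) (en : ε → Finset V) (U0 : Finset V)
    (hs : ∀ W ⊆ U0, 2 ≤ W.card → (F.filter (fun e => en e ⊆ W)).card + 3 ≤ 2 * W.card)
    (he : ∀ e ∈ F, 2 ≤ (en e).card) (α β γ : V)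
    (hU : ∀ U ⊆ U0, α ∈ U → β ∈ U → γ ∈ U →
      (F.filter (fun e => en e ⊆ U)).card + 4 ≤ 2 * U.card)
    (A B C : Finset V) (hA : A ⊆ U0) (hB : B ⊆ U0) (hC : C ⊆ U0)
    (tA : 2 * A.card ≤ (F.filter (fun e => en e ⊆ A)).card + 3)
    (tB : 2 * B.card ≤ (F.filter (fun e => en e ⊆ B)).card + 3)
    (tC : 2 * C.card ≤ (F.filter (fun e => en e ⊆ C)).card + 3)
    (a1 : α ∈ A) (a2 : β ∈ A) (b1 : β ∈ B) (b2 : γ ∈ B) (c1 : γ ∈ C) (c2 : α ∈ C) : False := by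
  set E : Finset V → Finset ε := fun W => F.filter (fun e => en e ⊆ W) with hE
  change 2 * A.card ≤ (E A).card + 3 at tA
  change 2 * B.card ≤ (E B).card + 3 at tB
  change 2 * C.card ≤ (E C).card + 3 at tC
  have hinter : ∀ X Y : Finset V, E X ∩ E Y = E (X ∩ Y) := by
    intro X Y
    ext e
    simp only [hE, Finset.mem_inter, Finset.mem_filter, Finset.subset_inter_iff]
    tauto
  have hmono : ∀ X Y : Finset V, X ⊆ Y → E X ⊆ E Y := by
    intro X Y hXY e h
    simp only [hE, Finset.mem_filter] at h ⊢
    exact ⟨h.1, h.2.trans hXY⟩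
  have hunion : ∀ X Y : Finset V, (E X).card + (E Y).card ≤ (E (X ∪ Y)).card + (E (X ∩ Y)).card := by
    intro X Y
    rw [← Finset.card_union_add_card_inter, hinter]
    have := Finset.card_le_card (Finset.union_subset (hmono X (X ∪ Y) Finset.subset_union_left)
      (hmono Y (X ∪ Y) Finset.subset_union_right))
    omega
  have key : ∀ X Y : Finset V, X ⊆ U0 → Y ⊆ U0 → 2 * X.card ≤ (E X).card + 3 →
      2 * Y.card ≤ (E Y).card + 3 → (X ∩ Y).Nonempty → α ∈ X ∪ Y → β ∈ X ∪ Y → γ ∈ X ∪ Y →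
      (X ∩ Y).card = 1 := by
    intro X Y hX hY tX tY hne h1 h2 h3
    by_contra hcard
    have hpos := hne.card_pos
    have h4 := hs (X ∩ Y) (Finset.inter_subset_left.trans hX) (by omega)
    have h5 := hU (X ∪ Y) (Finset.union_subset hX hY) h1 h2 h3
    have h6 := hunion X Y
    have h7 := Finset.card_union_add_card_inter X Y
    change (E (X ∩ Y)).card + 3 ≤ _ at h4
    change (E (X ∪ Y)).card + 4 ≤ _ at h5
    omega
  have small : ∀ X : Finset V, X.card ≤ 1 → (E X).card = 0 := by
    intro X hX
    rw [Finset.card_eq_zero, Finset.filter_eq_empty_iff]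
    intro e heF hsub
    have := he e heF
    have := Finset.card_le_card hsub
    omega
  have kAB := key A B hA hB tA tB ⟨β, by simp [a2, b1]⟩ (by simp [a1]) (by simp [a2]) (by simp [b2])
  have kBC := key B C hB hC tB tC ⟨γ, by simp [b2, c1]⟩ (by simp [c2]) (by simp [b1]) (by simp [b2])
  have kAC := key A C hA hC tA tC ⟨α, by simp [a1, c2]⟩ (by simp [a1]) (by simp [a2]) (by simp [c1])
  -- the intersections
  have u1 := hunion A B
  have u2 := hunion (A ∪ B) C
  have s1 := small _ kAB.le
  have n1 := Finset.card_union_add_card_inter A B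
  have n2 := Finset.card_union_add_card_inter (A ∪ B) C
  have u3 : ((A ∪ B) ∩ C).card ≤ 2 := by
    rw [Finset.union_inter_distrib_right]
    have := Finset.card_union_le (A ∩ C) (B ∩ C)
    omega
  have hUU := hU (A ∪ B ∪ C) (Finset.union_subset (Finset.union_subset hA hB) hC)
    (by simp [a1]) (by simp [a2]) (by simp [b2])
  change (E (A ∪ B ∪ C)).card + 4 ≤ _ at hUU
  by_cases hαγ : α = γ
  · -- degenerate: then α ∈ A ∩ B
    subst hαγ
    have h1 := hU (A ∪ B) (Finset.union_subset hA hB) (by simp [a1]) (by simp [a2]) (by simp [a1])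
    have h2 := hU A hA a1 a2 a1
    change (E A).card + 4 ≤ _ at h2
    omega
  have m1 : α ∈ (A ∪ B) ∩ C := by simp [a1, c2]
  have m2 : γ ∈ (A ∪ B) ∩ C := by simp [b2, c1]
  have u4 : 2 ≤ ((A ∪ B) ∩ C).card := by
    have : ({α, γ} : Finset V) ⊆ (A ∪ B) ∩ C := by
      intro x hx
      simp only [Finset.mem_insert, Finset.mem_singleton] at hx
      rcases hx with rfl | rfl <;> assumption
    have := Finset.card_le_card this
    rwa [Finset.card_pair hαγ] at this
  -- edges of C are disjoint from those of A and B
  have e1 : E A ∩ E C = ∅ := by rw [hinter]; exact Finset.card_eq_zero.mp (small _ kAC.le)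
  have e2 : E B ∩ E C = ∅ := by rw [hinter]; exact Finset.card_eq_zero.mp (small _ kBC.le)
  have e3 : (E A ∪ E B) ∩ E C = ∅ := by
    rw [Finset.union_inter_distrib_right, e1, e2]; simp
  have e4 := Finset.card_union_add_card_inter (E A ∪ E B) (E C)
  have e5 := Finset.card_union_add_card_inter (E A) (E B)
  rw [hinter, s1] at e5
  rw [e3, Finset.card_empty] at e4
  have e6 : E A ∪ E B ∪ E C ⊆ E (A ∪ B ∪ C) :=
    Finset.union_subset (Finset.union_subset
      (hmono _ _ (Finset.subset_union_left.trans Finset.subset_union_left))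
      (hmono _ _ (Finset.subset_union_right.trans Finset.subset_union_left)))
      (hmono _ _ Finset.subset_union_right)
  have e7 := Finset.card_le_card e6
  omega

def rho (P : Finset V) (g x : V) : V := if x ∈ P then g else x

def ends (P : Finset V) (g : V) (e : Sym2 V) : Finset V := (sym2Verts e).image (rho P g)

theorem ends_mk (P : Finset V) (g x y : V) : ends P g s(x, y) = {rho P g x, rho P g y} := by
  simp [ends, sym2Verts]

structure Sparse (P : Finset V) (g : V) (J : Finset V) (F : Finset (Sym2 V)) : Prop where
  valid : ∀ x y, s(x, y) ∈ F → x ∈ J ∪ P ∧ y ∈ J ∪ P ∧ rho P g x ≠ rho P g y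
  count : ∀ W ⊆ insert g J, 2 ≤ W.card →
    (F.filter (fun e => ends P g e ⊆ W)).card + 3 ≤ 2 * W.card

variable {P : Finset V} {g : V} {J : Finset V} {F : Finset (Sym2 V)}

theorem rho_mem {x : V} (hx : x ∈ J ∪ P) : rho P g x ∈ insert g J := by
  unfold rho
  split_ifs with h
  · simp
  · have : x ∈ J := by simpa [h] using hx
    simp [this]

theorem rho_inner (hd : Disjoint J P) {x : V} (hx : x ∈ J) : rho P g x = x := by
  have := Finset.disjoint_left.mp hd hx
  simp [rho, this]

theorem rho_eq_inner (hd : Disjoint J P) (hg : g ∈ P) {w x : V} (hw : w ∈ J) :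
    rho P g x = w ↔ x = w := by
  have h := Finset.disjoint_left.mp hd hw
  unfold rho
  split_ifs with h1
  · constructor
    · rintro rfl; exact absurd hg h
    · rintro rfl; exact absurd h1 h
  · rfl

theorem Sparse.ends_card (h : Sparse P g J F) {e : Sym2 V} (he : e ∈ F) :
    (ends P g e).card = 2 := by
  induction e with | _ x y =>
  rw [ends_mk, Finset.card_pair (h.valid x y he).2.2]

theorem Sparse.ends_sub (h : Sparse P g J F) {e : Sym2 V} (he : e ∈ F) :
    ends P g e ⊆ insert g J := by
  induction e with | _ x y =>
  obtain ⟨h1, h2, _⟩ := h.valid x y he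
  rw [ends_mk]
  intro z hz
  simp only [Finset.mem_insert, Finset.mem_singleton] at hz
  rcases hz with rfl | rfl
  · exact rho_mem h1
  · exact rho_mem h2

theorem Sparse.low_degree (h : Sparse P g J F) (hd : Disjoint J P) (hg : g ∈ P)
    (hJ : J.Nonempty) (o : Finset V) (ho : o.card ≤ 1) (hoJ : o ⊆ J) :
    ∃ w ∈ J, (w ∉ o ∧ (F.filter (fun e => w ∈ ends P g e)).card ≤ 3) ∨
      (F.filter (fun e => w ∈ ends P g e)).card ≤ 2 := by
  by_contra hcon
  push Not at hcon
  have hgJ : g ∉ J := fun hh => Finset.disjoint_left.mp hd hh hg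
  have hcard : (insert g J).card = J.card + 1 := Finset.card_insert_of_notMem hgJ
  have hpos := hJ.card_pos
  have h1 := h.count (insert g J) subset_rfl (by omega)
  rw [Finset.filter_true_of_mem (fun e he => h.ends_sub he), hcard] at h1
  have h2 : ∑ w ∈ J, (F.filter (fun e => w ∈ ends P g e)).card ≤ 2 * F.card := by
    have := Finset.sum_card_bipartiteAbove_eq_sum_card_bipartiteBelow
      (s := J) (t := F) (fun w e => w ∈ ends P g e)
    simp only [Finset.bipartiteAbove, Finset.bipartiteBelow] at this
    rw [this]
    calc _ ≤ ∑ e ∈ F, 2 := Finset.sum_le_sum fun e he => by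
          rw [← h.ends_card he]
          apply Finset.card_le_card
          intro x hx
          exact (Finset.mem_filter.mp hx).2
      _ = 2 * F.card := by simp [mul_comm]
  have h3 : ∑ w ∈ J, 4 ≤ ∑ w ∈ J, ((F.filter (fun e => w ∈ ends P g e)).card + if w ∈ o then 1 else 0) := by
    apply Finset.sum_le_sum
    intro w hw
    have := hcon w hw
    split_ifs with hwo
    · omega
    · have := this.1 hwo; omega
  rw [Finset.sum_add_distrib] at h3
  have h4 : (∑ w ∈ J, if w ∈ o then 1 else 0) = o.card := by
    rw [← Finset.sum_filter, Finset.sum_const, smul_eq_mul, mul_one]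
    congr 1
    ext x
    simp only [Finset.mem_filter]
    exact ⟨fun h => h.2, fun h => ⟨hoJ h, h⟩⟩
  rw [h4] at h3
  simp only [Finset.sum_const, smul_eq_mul] at h3
  omega

def F0 (P : Finset V) (g w : V) (F : Finset (Sym2 V)) : Finset (Sym2 V) :=
  F.filter (fun e => w ∉ ends P g e)

def nbr (J P : Finset V) (w : V) (F : Finset (Sym2 V)) : Finset V :=
  (J ∪ P).filter (fun x => s(w, x) ∈ F)

theorem F0_mk (hd : Disjoint J P) (hg : g ∈ P) {w : V} (hw : w ∈ J) {x y : V} :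
    s(x, y) ∈ F0 P g w F ↔ s(x, y) ∈ F ∧ x ≠ w ∧ y ≠ w := by
  simp only [F0, Finset.mem_filter, ends_mk, Finset.mem_insert, Finset.mem_singleton]
  rw [eq_comm, rho_eq_inner hd hg hw, eq_comm (a := w), rho_eq_inner hd hg hw]
  tauto

theorem Sparse.mem_nbr (h : Sparse P g J F) {w x : V} : x ∈ nbr J P w F ↔ s(w, x) ∈ F := by
  simp only [nbr, Finset.mem_filter]
  exact ⟨fun h => h.2, fun h' => ⟨(h.valid _ _ h').2.1, h'⟩⟩

theorem Sparse.cases_mem (h : Sparse P g J F) (hd : Disjoint J P) (hg : g ∈ P) {w : V}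
    (hw : w ∈ J) {e : Sym2 V} (he : e ∈ F) :
    e ∈ F0 P g w F ∨ ∃ x ∈ nbr J P w F, e = s(w, x) := by
  induction e with | _ x y =>
  by_cases hx : x = w
  · subst hx
    exact Or.inr ⟨y, h.mem_nbr.mpr he, rfl⟩
  by_cases hy : y = w
  · subst hy
    exact Or.inr ⟨x, h.mem_nbr.mpr (by rwa [Sym2.eq_swap]), Sym2.eq_swap⟩
  exact Or.inl ((F0_mk hd hg hw).mpr ⟨he, hx, hy⟩)

theorem Sparse.nbr_card (h : Sparse P g J F) (hd : Disjoint J P) (hg : g ∈ P) {w : V}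
    (hw : w ∈ J) : (nbr J P w F).card = (F.filter (fun e => w ∈ ends P g e)).card := by
  rw [← Finset.card_image_of_injective (nbr J P w F) (f := fun x => s(w, x))
    (fun a b hab => Sym2.congr_right.mp hab)]
  congr 1
  ext e
  simp only [Finset.mem_image, Finset.mem_filter]
  constructor
  · rintro ⟨x, hx, rfl⟩
    refine ⟨h.mem_nbr.mp hx, ?_⟩
    rw [ends_mk, rho_inner hd hw]; simp
  · rintro ⟨he, hwe⟩
    rcases h.cases_mem hd hg hw he with h0 | ⟨x, hx, rfl⟩
    · exact absurd hwe (Finset.mem_filter.mp h0).2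
    · exact ⟨x, hx, rfl⟩

theorem Sparse.nbr_ne (h : Sparse P g J F) (hd : Disjoint J P) (hg : g ∈ P) {w x : V}
    (hw : w ∈ J) (hx : x ∈ nbr J P w F) : x ≠ w ∧ rho P g x ≠ w ∧ x ∈ J ∪ P := by
  have h1 := h.valid _ _ (h.mem_nbr.mp hx)
  rw [rho_inner hd hw] at h1
  refine ⟨?_, h1.2.2.symm, h1.2.1⟩
  rintro rfl
  exact h1.2.2 (rho_inner hd hw).symm

theorem Sparse.nbr_inj (h : Sparse P g J F) (hd : Disjoint J P) (hg : g ∈ P) {w x y : V}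
    (hw : w ∈ J) (hx : x ∈ nbr J P w F) (hy : y ∈ nbr J P w F) (hxy : x ≠ y) :
    rho P g x ≠ rho P g y := by
  intro heq
  have h1 := h.nbr_ne hd hg hw hx
  have h2 := h.count {w, rho P g x} (by
    intro z hz
    simp only [Finset.mem_insert, Finset.mem_singleton] at hz
    rcases hz with rfl | rfl
    · simp [hw]
    · exact rho_mem h1.2.2) (by rw [Finset.card_pair h1.2.1.symm])
  rw [Finset.card_pair h1.2.1.symm] at h2
  have h3 : ({s(w, x), s(w, y)} : Finset (Sym2 V)) ⊆
      F.filter (fun e => ends P g e ⊆ {w, rho P g x}) := by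
    intro e he
    simp only [Finset.mem_insert, Finset.mem_singleton] at he
    rw [Finset.mem_filter]
    rcases he with rfl | rfl
    · exact ⟨h.mem_nbr.mp hx, by rw [ends_mk, rho_inner hd hw]⟩
    · exact ⟨h.mem_nbr.mp hy, by rw [ends_mk, rho_inner hd hw, heq]⟩
  have h4 := Finset.card_le_card h3
  rw [Finset.card_pair (fun hh => hxy (Sym2.congr_right.mp hh))] at h4
  omega

theorem Sparse.erase (h : Sparse P g J F) (hd : Disjoint J P) (hg : g ∈ P) {w : V}
    (hw : w ∈ J) : Sparse P g (J.erase w) (F0 P g w F) := by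
  constructor
  · intro x y hxy
    obtain ⟨h1, h2, h3⟩ := (F0_mk hd hg hw).mp hxy
    obtain ⟨h4, h5, h6⟩ := h.valid x y h1
    simp only [Finset.mem_union, Finset.mem_erase] at *
    tauto
  · intro W hW hc
    refine le_trans ?_ (h.count W (hW.trans (Finset.insert_subset_insert _ (Finset.erase_subset _ _))) hc)
    gcongr
    exact Finset.filter_subset _ _

theorem Sparse.reduce3 (h : Sparse P g J F) (hd : Disjoint J P) (hg : g ∈ P) {w : V}
    (hw : w ∈ J) (h3 : (nbr J P w F).card = 3) :
    ∃ a b c, a ≠ b ∧ a ≠ c ∧ b ≠ c ∧ nbr J P w F = {a, b, c} ∧ s(a, b) ∉ F0 P g w F ∧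
      Sparse P g (J.erase w) (insert s(a, b) (F0 P g w F)) := by
  have hs := h.erase hd hg hw
  have hgw : g ≠ w := by rintro rfl; exact Finset.disjoint_left.mp hd hw hg
  have hmem : ∀ x ∈ nbr J P w F, x ∈ J.erase w ∪ P := by
    intro x hx
    obtain ⟨h1, _, h2⟩ := h.nbr_ne hd hg hw hx
    simp only [Finset.mem_union, Finset.mem_erase] at *
    tauto
  -- unblocked pairs suffice
  have main : ∀ a ∈ nbr J P w F, ∀ b ∈ nbr J P w F, a ≠ b →
      (∀ W ⊆ insert g (J.erase w), rho P g a ∈ W → rho P g b ∈ W →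
        ¬ 2 * W.card ≤ ((F0 P g w F).filter (fun e => ends P g e ⊆ W)).card + 3) →
      s(a, b) ∉ F0 P g w F ∧ Sparse P g (J.erase w) (insert s(a, b) (F0 P g w F)) := by
    intro a ha b hb hab hW
    have hrab := h.nbr_inj hd hg hw ha hb hab
    refine ⟨?_, ?_, ?_⟩
    · intro hin
      apply hW {rho P g a, rho P g b} _ (by simp) (by simp)
      · rw [Finset.card_pair hrab]
        have : 0 < ((F0 P g w F).filter
            (fun e => ends P g e ⊆ {rho P g a, rho P g b})).card := by
          apply Finset.card_pos.mpr
          exact ⟨s(a, b), Finset.mem_filter.mpr ⟨hin, by rw [ends_mk]⟩⟩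
        omega
      · intro z hz
        simp only [Finset.mem_insert, Finset.mem_singleton] at hz
        rcases hz with rfl | rfl
        · exact rho_mem (hmem _ ha)
        · exact rho_mem (hmem _ hb)
    · intro x y hxy
      rcases Finset.mem_insert.mp hxy with heq | hin
      · rcases Sym2.eq_iff.mp heq with ⟨rfl, rfl⟩ | ⟨rfl, rfl⟩
        · exact ⟨hmem _ ha, hmem _ hb, hrab⟩
        · exact ⟨hmem _ hb, hmem _ ha, hrab.symm⟩
      · exact hs.valid x y hin
    · intro W hWs hc
      have h1 := hs.count W hWs hc
      rw [Finset.filter_insert]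
      split_ifs with hsub
      · rw [ends_mk, Finset.insert_subset_iff, Finset.singleton_subset_iff] at hsub
        have h2 := hW W hWs hsub.1 hsub.2
        have h3 := Finset.card_insert_le s(a, b) ((F0 P g w F).filter (fun e => ends P g e ⊆ W))
        omega
      · exact h1
  obtain ⟨a, b, c, hab, hac, hbc, hN⟩ := Finset.card_eq_three.mp h3
  have ha : a ∈ nbr J P w F := by rw [hN]; simp
  have hb : b ∈ nbr J P w F := by rw [hN]; simp
  have hc : c ∈ nbr J P w F := by rw [hN]; simp
  by_contra hcon
  have nab : ¬ (s(a, b) ∉ F0 P g w F ∧ Sparse P g (J.erase w) (insert s(a, b) (F0 P g w F))) :=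
    fun hh => hcon ⟨a, b, c, hab, hac, hbc, hN, hh.1, hh.2⟩
  have nbc : ¬ (s(b, c) ∉ F0 P g w F ∧ Sparse P g (J.erase w) (insert s(b, c) (F0 P g w F))) :=
    fun hh => hcon ⟨b, c, a, hbc, hab.symm, hac.symm, by
      rw [hN]; ext; simp; tauto, hh.1, hh.2⟩
  have nca : ¬ (s(c, a) ∉ F0 P g w F ∧ Sparse P g (J.erase w) (insert s(c, a) (F0 P g w F))) :=
    fun hh => hcon ⟨c, a, b, hac.symm, hbc.symm, hab, by
      rw [hN]; ext; simp; tauto, hh.1, hh.2⟩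
  have mab := mt (main a ha b hb hab) nab
  have mbc := mt (main b hb c hc hbc) nbc
  have mca := mt (main c hc a ha hac.symm) nca
  push Not at mab mbc mca
  obtain ⟨A, hA, a1, a2, tA⟩ := mab
  obtain ⟨B, hB, b1, b2, tB⟩ := mbc
  obtain ⟨C, hC, c1, c2, tC⟩ := mca
  refine three_blocks (F0 P g w F) (ends P g) (insert g (J.erase w)) hs.count
    (fun e he => (hs.ends_card he).ge) (rho P g a) (rho P g b) (rho P g c) ?_
    A B C hA hB hC tA tB tC a1 a2 b1 b2 c1 c2
  intro U hU ua ub uc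
  have hwU : w ∉ U := by
    intro hwU
    have := hU hwU
    simp [hgw.symm] at this
  have hcU : (insert w U).card = U.card + 1 := Finset.card_insert_of_notMem hwU
  have hpos : 0 < U.card := Finset.card_pos.mpr ⟨_, ua⟩
  have h1 := h.count (insert w U) (by
    intro z hz
    rcases Finset.mem_insert.mp hz with rfl | hz
    · simp [hw]
    · have := hU hz
      simp only [Finset.mem_insert, Finset.mem_erase] at this ⊢
      tauto) (by omega)
  have h2 : ((F0 P g w F).filter (fun e => ends P g e ⊆ U)) ∪ (nbr J P w F).image (fun x => s(w, x))
      ⊆ F.filter (fun e => ends P g e ⊆ insert w U) := by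
    intro e he
    rw [Finset.mem_filter]
    rcases Finset.mem_union.mp he with he | he
    · obtain ⟨h3, h4⟩ := Finset.mem_filter.mp he
      exact ⟨(Finset.mem_filter.mp h3).1, h4.trans (Finset.subset_insert _ _)⟩
    · obtain ⟨x, hx, rfl⟩ := Finset.mem_image.mp he
      refine ⟨h.mem_nbr.mp hx, ?_⟩
      rw [ends_mk, rho_inner hd hw]
      apply Finset.insert_subset_insert
      rw [Finset.singleton_subset_iff]
      rw [hN] at hx
      simp only [Finset.mem_insert, Finset.mem_singleton] at hx
      rcases hx with rfl | rfl | rfl <;> assumption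
  have h5 := Finset.card_le_card h2
  rw [Finset.card_union_of_disjoint, Finset.card_image_of_injective, h3] at h5
  · omega
  · intro x y hxy; exact Sym2.congr_right.mp hxy
  · rw [Finset.disjoint_left]
    intro e he he'
    obtain ⟨x, hx, rfl⟩ := Finset.mem_image.mp he'
    have := (F0_mk hd hg hw).mp (Finset.mem_filter.mp he).1
    exact this.2.1 rfl
end
section
set_option linter.unusedSectionVars false
set_option linter.unusedVariables false
variable {V : Type*} [DecidableEq V] {I P : Finset V} {g : V} {J : Finset V} {F : Finset (Sym2 V)}
  {p : V → ℝ × ℝ}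

theorem solve2 (u v : ℝ × ℝ) (h : cr u v ≠ 0) (r s : ℝ) : ∃ y, dot u y = r ∧ dot v y = s := by
  refine ⟨((r * v.2 - s * u.2) / cr u v, (u.1 * s - v.1 * r) / cr u v), ?_, ?_⟩
  · simp only [dot]
    field_simp
    simp only [cr]; ring
  · simp only [dot]
    field_simp
    simp only [cr]; ring

theorem solve1 (u : ℝ × ℝ) (h : u.1 ≠ 0) (r z : ℝ) : ∃ x : ℝ, dot u (x, z) = r :=
  ⟨(r - u.2 * z) / u.1, by simp only [dot]; field_simp; ring⟩

theorem solve1' (u : ℝ × ℝ) (h : u.2 ≠ 0) (r z : ℝ) : ∃ x : ℝ, dot u (z, x) = r :=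
  ⟨(r - u.1 * z) / u.2, by simp only [dot]; field_simp; ring⟩

theorem dot_sub' (u y z : ℝ × ℝ) : dot u (y - z) = dot u y - dot u z := by
  simp only [dot, Prod.fst_sub, Prod.snd_sub]; ring

theorem ext_aux (h : Sparse P g J F) (hd : Disjoint J P) (hg : g ∈ P) {w : V} (hw : w ∈ J)
    (p q : V → ℝ × ℝ) (hq : ∀ x, x ≠ w → q x = p x) (m : V → ℝ × ℝ)
    (hm : ∀ x ∉ J.erase w, m x = 0) (t : Sym2 V → ℝ) (hrow : ∀ e ∈ F0 P g w F, rvL p e m = t e)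
    (y : ℝ × ℝ) (hy : ∀ x ∈ nbr J P w F, dot (q w - p x) y = t s(w, x) + dot (q w - p x) (m x)) :
    (∀ x ∉ J, Function.update m w y x = 0) ∧ ∀ e ∈ F, rvL q e (Function.update m w y) = t e := by
  constructor
  · intro x hx
    have h1 : x ≠ w := by rintro rfl; exact hx hw
    rw [Function.update_of_ne h1]
    exact hm x (fun hh => hx (Finset.mem_of_mem_erase hh))
  · intro e he
    rcases h.cases_mem hd hg hw he with h0 | ⟨x, hx, rfl⟩
    · rw [← hrow e h0]
      induction e with | _ i j =>
      obtain ⟨_, hi, hj⟩ := (F0_mk hd hg hw).mp h0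
      rw [rvL_mk, rvL_mk, Function.update_of_ne hi, Function.update_of_ne hj, hq i hi, hq j hj]
    · have hne := (h.nbr_ne hd hg hw hx).1
      rw [rvL_mk, Function.update_self, Function.update_of_ne hne, hq x hne, dot_sub', hy x hx]
      ring

theorem noncol3 (hd : Disjoint I P) (hgen : GenericOverPins I P p) {a b c : V}
    (ha : a ∈ I ∪ P) (hb : b ∈ I ∪ P) (hc : c ∈ I ∪ P) (hab : rho P g a ≠ rho P g b)
    (hac : rho P g a ≠ rho P g c) (hbc : rho P g b ≠ rho P g c) :
    cr (p a - p b) (p a - p c) ≠ 0 := by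
  have nab : a ≠ b := by rintro rfl; exact hab rfl
  have nac : a ≠ c := by rintro rfl; exact hac rfl
  have nbc : b ≠ c := by rintro rfl; exact hbc rfl
  have two : ∀ x y, rho P g x ≠ rho P g y → x ∈ P → y ∈ P → False := by
    intro x y h hx hy
    exact h (by simp [rho, hx, hy])
  have key : (a ∈ I ∧ b ∈ I) ∨ (a ∈ I ∧ c ∈ I) ∨ (b ∈ I ∧ c ∈ I) := by
    have h1 := two _ _ hab
    have h2 := two _ _ hac
    have h3 := two _ _ hbc
    simp only [Finset.mem_union] at ha hb hc
    tauto
  rcases key with ⟨h1, h2⟩ | ⟨h1, h2⟩ | ⟨h1, h2⟩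
  · have := noncol hd hgen h1 h2 hc nab nac nbc
    intro h0; apply this; rw [← h0]
    simp only [cr, Prod.fst_sub, Prod.snd_sub]; ring
  · have := noncol hd hgen h1 h2 hb nac nab nbc.symm
    intro h0; apply this; rw [← neg_eq_zero, ← h0]
    simp only [cr, Prod.fst_sub, Prod.snd_sub]; ring
  · have := noncol hd hgen h1 h2 ha nbc nab.symm nac.symm
    intro h0; apply this; rw [← h0]
    simp only [cr, Prod.fst_sub, Prod.snd_sub]; ring

theorem laman (hdIP : Disjoint I P) (hgen : GenericOverPins I P p) (hg : g ∈ P) :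
    ∀ (n : ℕ) (J : Finset V) (F : Finset (Sym2 V)), J.card = n → J ⊆ I → Sparse P g J F →
      ∀ o ⊆ J, o.card ≤ 1 → ∃ d : Bool, Good J F (o.image (fun v => (v, d))) p := by
  intro n
  induction n with
  | zero =>
    intro J F hJ hJI hS o ho hoc
    have hJ0 : J = ∅ := Finset.card_eq_zero.mp hJ
    subst hJ0
    have ho0 : o = ∅ := Finset.subset_empty.mp ho
    subst ho0
    refine ⟨true, fun t s => ⟨fun _ => 0, fun _ _ => rfl, ?_, by simp⟩⟩
    intro e he
    have h1 := hS.ends_card he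
    have h2 := Finset.card_le_card (hS.ends_sub he)
    simp at h2
    omega
  | succ n ih =>
    intro J F hJ hJI hS o ho hoc
    have hd : Disjoint J P := Finset.disjoint_of_subset_left hJI hdIP
    have hJne : J.Nonempty := Finset.card_pos.mp (by omega)
    have hJP : J ∪ P ⊆ I ∪ P := Finset.union_subset_union_left hJI
    have hFIP : ∀ x y, s(x, y) ∈ F → x ∈ I ∪ P ∧ y ∈ I ∪ P := fun x y hxy =>
      ⟨hJP (hS.valid x y hxy).1, hJP (hS.valid x y hxy).2.1⟩
    obtain ⟨w, hw, hdeg⟩ := hS.low_degree hd hg hJne o hoc ho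
    rw [← hS.nbr_card hd hg hw] at hdeg
    have hwI := hJI hw
    have hcard : (J.erase w).card = n := by rw [Finset.card_erase_of_mem hw]; omega
    have hJ' : J.erase w ⊆ I := (Finset.erase_subset _ _).trans hJI
    have hN : ∀ x ∈ nbr J P w F, x ≠ w ∧ rho P g x ≠ w ∧ x ∈ I ∪ P := fun x hx =>
      ⟨(hS.nbr_ne hd hg hw hx).1, (hS.nbr_ne hd hg hw hx).2.1, hJP (hS.nbr_ne hd hg hw hx).2.2⟩
    have hoff : ∀ z : ℝ × ℝ, ∀ x, x ≠ w → Function.update p w z x = p x := fun z x hx =>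
      Function.update_of_ne hx _ _
    have hoffI : ∀ z : ℝ × ℝ, ∀ x ∉ I, Function.update p w z x = p x := fun z x hx =>
      hoff z x (by rintro rfl; exact hx hwI)
    by_cases hwo : w ∈ o
    · -- target vertex of degree at most two
      have hdeg2 : (nbr J P w F).card ≤ 2 := by
        rcases hdeg with h | h
        · exact absurd hwo h.1
        · exact h
      have hoeq : o = {w} := by
        apply (Finset.eq_singleton_iff_unique_mem).mpr
        exact ⟨hwo, fun x hx => Finset.card_le_one.mp hoc x hx w hwo⟩
      subst hoeq
      simp only [Finset.image_singleton]
      by_cases hex : ∃ a ∈ nbr J P w F, a ∈ J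
      · obtain ⟨a, haN, haJ⟩ := hex
        have haw := (hN a haN).1
        obtain ⟨d, hgood⟩ := ih (J.erase w) (F0 P g w F) hcard hJ' (hS.erase hd hg hw) {a}
          (by simp [haw, haJ]) (by simp)
        simp only [Finset.image_singleton] at hgood
        refine ⟨d, good_transfer hdIP hgen J F _ hFIP
          (Function.update p w (p a + if d then (1, 0) else (0, 1))) (hoffI _) ?_⟩
        intro t s
        obtain ⟨m, hm, hrow, hT⟩ := hgood t (fun _ => s (w, d) - t s(w, a))
        have hT' := hT (a, d) (by simp)
        simp only at hT'
        have hone : ∀ b ∈ nbr J P w F, b ≠ a → ∀ c ∈ nbr J P w F, c ≠ a → b = c := by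
          intro b hb hba c hc hca
          have : ((nbr J P w F).erase a).card ≤ 1 := by
            rw [Finset.card_erase_of_mem haN]; omega
          exact Finset.card_le_one.mp this b (Finset.mem_erase.mpr ⟨hba, hb⟩) c
            (Finset.mem_erase.mpr ⟨hca, hc⟩)
        have hsol : ∃ y : ℝ × ℝ, prj d y = s (w, d) ∧ ∀ b ∈ nbr J P w F, b ≠ a →
            dot ((p a + if d then (1, 0) else (0, 1)) - p b) y =
              t s(w, b) + dot ((p a + if d then (1, 0) else (0, 1)) - p b) (m b) := by
          by_cases hb : ∃ b ∈ nbr J P w F, b ≠ a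
          · obtain ⟨b, hbN, hba⟩ := hb
            have hne := coord_ne hdIP hgen (hJI haJ) (hN b hbN).2.2 hba.symm (!d)
            have : ∃ y : ℝ × ℝ, prj d y = s (w, d) ∧
                dot ((p a + if d then (1, 0) else (0, 1)) - p b) y =
              t s(w, b) + dot ((p a + if d then (1, 0) else (0, 1)) - p b) (m b) := by
              cases d with
              | true =>
                obtain ⟨x, hx⟩ := solve1' ((p a + if true = true then (1, 0) else (0, 1)) - p b)
                  (by simpa [prj] using hne)
                  (t s(w, b) + dot ((p a + if true = true then (1, 0) else (0, 1)) - p b) (m b))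
                  (s (w, true))
                exact ⟨_, rfl, hx⟩
              | false =>
                obtain ⟨x, hx⟩ := solve1 ((p a + if false = true then (1, 0) else (0, 1)) - p b)
                  (by simpa [prj] using hne)
                  (t s(w, b) + dot ((p a + if false = true then (1, 0) else (0, 1)) - p b) (m b))
                  (s (w, false))
                exact ⟨_, rfl, hx⟩
            obtain ⟨y, hy1, hy2⟩ := this
            refine ⟨y, hy1, fun c hc hca => ?_⟩
            rw [hone c hc hca b hbN hba]
            exact hy2
          · push Not at hb
            refine ⟨(s (w, d), s (w, d)), by unfold prj; split_ifs <;> rfl, ?_⟩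
            intro b hb' hba
            exact absurd (hb b hb') hba
        obtain ⟨y, hy1, hy2⟩ := hsol
        obtain ⟨r1, r2⟩ := ext_aux hS hd hg hw p (Function.update p w (p a + if d then (1, 0) else (0, 1))) (hoff _) m hm t hrow y (by
          intro x hx
          rw [Function.update_self]
          by_cases hxa : x = a
          · subst hxa
            rw [add_sub_cancel_left]
            cases d <;> simp [prj, dot] at hT' hy1 ⊢ <;> linarith
          · exact hy2 x hx hxa)
        refine ⟨_, r1, r2, ?_⟩
        intro z hz
        rw [Finset.mem_singleton] at hz
        subst hz
        simp only [Function.update_self]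
        exact hy1
      · push Not at hex
        obtain ⟨d0, hgood⟩ := ih (J.erase w) (F0 P g w F) hcard hJ' (hS.erase hd hg hw) ∅
          (by simp) (by simp)
        refine ⟨false, fun t s => ?_⟩
        obtain ⟨m, hm, hrow, _⟩ := hgood t s
        have hone : ∀ b ∈ nbr J P w F, ∀ c ∈ nbr J P w F, b = c := by
          intro b hb c hc
          by_contra hbc
          apply hS.nbr_inj hd hg hw hb hc hbc
          have hbP : b ∈ P := by
            have := (hS.nbr_ne hd hg hw hb).2.2
            simpa [hex b hb] using this
          have hcP : c ∈ P := by
            have := (hS.nbr_ne hd hg hw hc).2.2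
            simpa [hex c hc] using this
          simp [rho, hbP, hcP]
        have hsol : ∃ y : ℝ × ℝ, y.2 = s (w, false) ∧ ∀ b ∈ nbr J P w F,
            dot (p w - p b) y = t s(w, b) + dot (p w - p b) (m b) := by
          by_cases hb : ∃ b, b ∈ nbr J P w F
          · obtain ⟨b, hbN⟩ := hb
            have hne := coord_ne hdIP hgen hwI (hN b hbN).2.2 (hN b hbN).1.symm true
            obtain ⟨x, hx⟩ := solve1 (p w - p b) (by simpa [prj] using hne)
              (t s(w, b) + dot (p w - p b) (m b)) (s (w, false))
            refine ⟨(x, s (w, false)), rfl, fun c hc => ?_⟩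
            rw [hone c hc b hbN]; exact hx
          · push Not at hb
            exact ⟨(0, s (w, false)), rfl, fun b hb' => absurd hb' (hb b)⟩
        obtain ⟨y, hy1, hy2⟩ := hsol
        obtain ⟨r1, r2⟩ := ext_aux hS hd hg hw p p (fun _ _ => rfl) m hm t hrow y hy2
        refine ⟨_, r1, r2, ?_⟩
        intro z hz
        rw [Finset.mem_singleton] at hz
        subst hz
        simp only [Function.update_self]
        simpa [prj] using hy1
    · have hoJ' : o ⊆ J.erase w := fun x hx =>
        Finset.mem_erase.mpr ⟨by rintro rfl; exact hwo hx, ho hx⟩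
      have hTw : ∀ d : Bool, ∀ y ∈ o.image (fun v => (v, d)), y.1 ≠ w := by
        intro d y hy
        obtain ⟨v, hv, rfl⟩ := Finset.mem_image.mp hy
        rintro rfl
        exact hwo hv
      by_cases h3 : (nbr J P w F).card = 3
      · obtain ⟨a, b, c, hab, hac, hbc, hNeq, hnot, hS'⟩ := hS.reduce3 hd hg hw h3
        have haN : a ∈ nbr J P w F := by rw [hNeq]; simp
        have hbN : b ∈ nbr J P w F := by rw [hNeq]; simp
        have hcN : c ∈ nbr J P w F := by rw [hNeq]; simp
        obtain ⟨d, hgood⟩ := ih (J.erase w) _ hcard hJ' hS' o hoJ' hoc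
        have hcr : cr (p a - p b) (p a - p c) ≠ 0 := noncol3 (g := g) hdIP hgen (hN a haN).2.2
          (hN b hbN).2.2 (hN c hcN).2.2 (hS.nbr_inj hd hg hw haN hbN hab)
          (hS.nbr_inj hd hg hw haN hcN hac) (hS.nbr_inj hd hg hw hbN hcN hbc)
        refine ⟨d, good_transfer hdIP hgen J F _ hFIP
          (Function.update p w (((p a).1 + (p b).1) / 2, ((p a).2 + (p b).2) / 2)) (hoffI _) ?_⟩
        intro t s
        obtain ⟨m, hm, hrow, hT⟩ := hgood
          (Function.update t s(a, b) (2 * (t s(w, a) + t s(w, b)))) s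
        have hrab := hrow s(a, b) (Finset.mem_insert_self _ _)
        rw [Function.update_self, rvL_mk] at hrab
        have hrow' : ∀ e ∈ F0 P g w F, rvL p e m = t e := by
          intro e he
          rw [hrow e (Finset.mem_insert_of_mem he), Function.update_of_ne]
          rintro rfl
          exact hnot he
        set z : ℝ × ℝ := (((p a).1 + (p b).1) / 2, ((p a).2 + (p b).2) / 2) with hz
        obtain ⟨y, hy1, hy2⟩ := solve2 (z - p a) (z - p c) (by
          intro h0; apply hcr
          simp only [cr, hz, Prod.fst_sub, Prod.snd_sub] at h0 ⊢
          linarith) (t s(w, a) + dot (z - p a) (m a)) (t s(w, c) + dot (z - p c) (m c))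
        obtain ⟨r1, r2⟩ := ext_aux hS hd hg hw p _ (hoff z) m hm t hrow' y (by
          intro x hx
          rw [Function.update_self]
          rw [hNeq] at hx
          simp only [Finset.mem_insert, Finset.mem_singleton] at hx
          rcases hx with rfl | rfl | rfl
          · exact hy1
          · simp only [dot, hz, Prod.fst_sub, Prod.snd_sub] at hy1 hrab ⊢
            linarith
          · exact hy2)
        refine ⟨_, r1, r2, ?_⟩
        intro e he
        rw [Function.update_of_ne (hTw d e he)]
        exact hT e he
      · have hdeg2 : (nbr J P w F).card ≤ 2 := by
          rcases hdeg with h | h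
          · have := h.2; omega
          · exact h
        obtain ⟨d, hgood⟩ := ih (J.erase w) _ hcard hJ' (hS.erase hd hg hw) o hoJ' hoc
        refine ⟨d, fun t s => ?_⟩
        obtain ⟨m, hm, hrow, hT⟩ := hgood t s
        have hsol : ∃ y : ℝ × ℝ, ∀ b ∈ nbr J P w F,
            dot (p w - p b) y = t s(w, b) + dot (p w - p b) (m b) := by
          have h012 : (nbr J P w F).card = 0 ∨ (nbr J P w F).card = 1 ∨ (nbr J P w F).card = 2 := by
            omega
          rcases h012 with h | h | h
          · rw [Finset.card_eq_zero] at h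
            rw [h]
            exact ⟨0, by simp⟩
          · obtain ⟨b, hb⟩ := Finset.card_eq_one.mp h
            have hbN : b ∈ nbr J P w F := by rw [hb]; simp
            have hne := coord_ne hdIP hgen hwI (hN b hbN).2.2 (hN b hbN).1.symm true
            obtain ⟨x, hx⟩ := solve1 (p w - p b) (by simpa [prj] using hne)
              (t s(w, b) + dot (p w - p b) (m b)) 0
            refine ⟨(x, 0), ?_⟩
            rw [hb]
            simpa using hx
          · obtain ⟨a, b, hab, heq⟩ := Finset.card_eq_two.mp h
            have haN : a ∈ nbr J P w F := by rw [heq]; simp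
            have hbN : b ∈ nbr J P w F := by rw [heq]; simp
            have hrw : rho P g w = w := rho_inner hd hw
            obtain ⟨y, hy1, hy2⟩ := solve2 (p w - p a) (p w - p b)
              (noncol3 (g := g) hdIP hgen (Finset.mem_union_left _ hwI) (hN a haN).2.2
                (hN b hbN).2.2 (by rw [hrw]; exact (hN a haN).2.1.symm)
                (by rw [hrw]; exact (hN b hbN).2.1.symm) (hS.nbr_inj hd hg hw haN hbN hab))
              (t s(w, a) + dot (p w - p a) (m a)) (t s(w, b) + dot (p w - p b) (m b))
            refine ⟨y, ?_⟩
            rw [heq]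
            intro x hx
            simp only [Finset.mem_insert, Finset.mem_singleton] at hx
            rcases hx with rfl | rfl
            · exact hy1
            · exact hy2
        obtain ⟨y, hy⟩ := hsol
        obtain ⟨r1, r2⟩ := ext_aux hS hd hg hw p p (fun _ _ => rfl) m hm t hrow y hy
        refine ⟨_, r1, r2, ?_⟩
        intro e he
        rw [Function.update_of_ne (hTw d e he)]
        exact hT e he

theorem initial_sparse {E : Finset (Sym2 V)} (hG : IsPinnedGraph I P E)
    (hPFC : PinnedConditions I P E) (hmin : IsMinimalPinned I P E) (hg : g ∈ P)
    {u : V} (hu : u ∈ I) :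
    Sparse P g (I.erase u) (E.filter (fun e => u ∉ sym2Verts e)) := by
  have hmk : ∀ x y : V, sym2Verts s(x, y) = {x, y} := fun _ _ => rfl
  have huP : u ∉ P := Finset.disjoint_left.mp hG.disj hu
  constructor
  · intro x y hxy
    obtain ⟨hE, hu'⟩ := Finset.mem_filter.mp hxy
    have h1 := hG.endpoints _ hE
    have h2 := hG.inner _ hE
    have h3 := hG.not_diag _ hE
    rw [hmk] at h1 h2 hu'
    rw [Sym2.mk_isDiag_iff] at h3
    simp only [Finset.mem_insert, Finset.mem_singleton, not_or] at hu'
    rw [Finset.insert_subset_iff, Finset.singleton_subset_iff] at h1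
    have hx := h1.1
    have hy := h1.2
    have hIP : ∀ z, z ∈ I → z ∉ P := fun z hz => Finset.disjoint_left.mp hG.disj hz
    have h4 : x ∈ I ∨ y ∈ I := by
      obtain ⟨z, hz⟩ := h2
      simp only [Finset.mem_inter, Finset.mem_insert, Finset.mem_singleton] at hz
      rcases hz with ⟨rfl | rfl, hz⟩
      · exact Or.inl hz
      · exact Or.inr hz
    simp only [Finset.mem_union, Finset.mem_erase] at *
    refine ⟨?_, ?_, ?_⟩
    · rcases hx with h | h
      · exact Or.inl ⟨fun h' => hu'.1 h'.symm, h⟩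
      · exact Or.inr h
    · rcases hy with h | h
      · exact Or.inl ⟨fun h' => hu'.2 h'.symm, h⟩
      · exact Or.inr h
    · unfold rho
      split_ifs with a b b
      · rcases h4 with h | h
        · exact absurd a (hIP _ h)
        · exact absurd b (hIP _ h)
      · rintro rfl; exact b hg
      · rintro rfl; exact a hg
      · exact h3
  · intro W hW hc
    set E' := (E.filter (fun e => u ∉ sym2Verts e)).filter (fun e => ends P g e ⊆ W) with hE'
    have hsub : ∀ x y : V, s(x, y) ∈ E' → s(x, y) ∈ E ∧ rho P g x ∈ W ∧ rho P g y ∈ W := by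
      intro x y h
      obtain ⟨h1, h2⟩ := Finset.mem_filter.mp h
      rw [ends_mk, Finset.insert_subset_iff, Finset.singleton_subset_iff] at h2
      exact ⟨(Finset.mem_filter.mp h1).1, h2⟩
    by_cases hgW : g ∈ W
    · have hI' : W.erase g ⊆ I.erase u := by
        intro x hx
        obtain ⟨h1, h2⟩ := Finset.mem_erase.mp hx
        exact (Finset.mem_insert.mp (hW h2)).resolve_left h1
      have hcard := Finset.card_erase_of_mem hgW
      have hm := hmin (W.erase g) (hI'.trans (Finset.erase_subset _ _)) P subset_rfl (by
        rw [Finset.ssubset_iff_of_subset (Finset.union_subset_union_left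
          (hI'.trans (Finset.erase_subset _ _)))]
        refine ⟨u, Finset.mem_union_left _ hu, ?_⟩
        intro hh
        rcases Finset.mem_union.mp hh with hh | hh
        · exact absurd (hI' hh) (by simp)
        · exact huP hh)
      have hle : E' ⊆ inducedEdges (W.erase g) P E := by
        intro e he
        induction e with | _ x y =>
        obtain ⟨h1, h2, h3⟩ := hsub x y he
        have key : ∀ z, rho P g z ∈ W → z ∈ W.erase g ∪ P := by
          intro z hz
          by_cases hzP : z ∈ P
          · exact Finset.mem_union_right _ hzP
          · simp only [rho, hzP, if_false] at hz
            apply Finset.mem_union_left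
            exact Finset.mem_erase.mpr ⟨by rintro rfl; exact hzP hg, hz⟩
        refine Finset.mem_filter.mpr ⟨h1, ?_, ?_⟩
        · rw [hmk, Finset.insert_subset_iff, Finset.singleton_subset_iff]
          exact ⟨key x h2, key y h3⟩
        · obtain ⟨z, hz⟩ := hG.inner _ h1
          rw [hmk, Finset.mem_inter] at hz
          refine ⟨z, ?_⟩
          rw [hmk, Finset.mem_inter]
          refine ⟨hz.1, ?_⟩
          have hzP : z ∉ P := Finset.disjoint_left.mp hG.disj hz.2
          have : z ∈ W.erase g ∪ P := by
            have := hz.1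
            simp only [Finset.mem_insert, Finset.mem_singleton] at this
            rcases this with rfl | rfl
            · exact key _ h2
            · exact key _ h3
          exact (Finset.mem_union.mp this).resolve_right hzP
      have := Finset.card_le_card hle
      omega
    · by_cases hne : E'.Nonempty
      · have hV : edgeVerts E' ⊆ W := by
          unfold edgeVerts
          apply Finset.sup_le
          intro e he
          induction e with | _ x y =>
          obtain ⟨h1, h2, h3⟩ := hsub x y he
          have key : ∀ z, rho P g z ∈ W → z ∈ W := by
            intro z hz
            unfold rho at hz
            split_ifs at hz
            · exact absurd hz hgW
            · exact hz
          rw [hmk, Finset.le_iff_subset, Finset.insert_subset_iff, Finset.singleton_subset_iff]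
          exact ⟨key x h2, key y h3⟩
        have hWI : W ⊆ I := by
          intro x hx
          rcases Finset.mem_insert.mp (hW hx) with rfl | h
          · exact absurd hx hgW
          · exact Finset.mem_of_mem_erase h
        have h1 := (hPFC.2 E' ((Finset.filter_subset _ _).trans (Finset.filter_subset _ _)) hne).2.2 (by
          rw [← Finset.disjoint_iff_inter_eq_empty]
          exact Finset.disjoint_of_subset_left (hV.trans hWI) hG.disj)
        have h2 := Finset.card_le_card (Finset.inter_subset_left.trans hV : edgeVerts E' ∩ I ⊆ W)
        omega
      · rw [Finset.not_nonempty_iff_eq_empty] at hne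
        rw [hne, Finset.card_empty]
        omega

/-- combining finitely many motions -/
theorem combine (K : Submodule ℝ (V → ℝ × ℝ)) (S : Finset V)
    (h : ∀ v ∈ S, ∃ m ∈ K, m v ≠ 0) : ∃ m ∈ K, ∀ v ∈ S, m v ≠ 0 := by
  induction S using Finset.induction_on with
  | empty => exact ⟨0, K.zero_mem, by simp⟩
  | insert a S ha ih =>
    obtain ⟨m, hm, hmS⟩ := ih (fun v hv => h v (Finset.mem_insert_of_mem hv))
    obtain ⟨m', hm', hma⟩ := h a (Finset.mem_insert_self _ _)
    -- bad scalars: for each v at most one c with m v + c • m' v = 0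
    have hbad : ∀ v ∈ insert a S, {c : ℝ | m v + c • m' v = 0}.Finite := by
      intro v hv
      by_cases h0 : m' v = 0
      · have hvS : v ∈ S := by
          rcases Finset.mem_insert.mp hv with rfl | hh
          · exact absurd h0 hma
          · exact hh
        have : {c : ℝ | m v + c • m' v = 0} = ∅ := by
          ext c
          simp [h0, hmS v hvS]
        rw [this]; exact Set.finite_empty
      · apply Set.Subsingleton.finite
        intro c hc c' hc'
        simp only [Set.mem_setOf_eq] at hc hc'
        have : (c - c') • m' v = 0 := by
          rw [sub_smul, ← hc'.trans hc.symm |> add_left_cancel, sub_self]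
        rcases smul_eq_zero.mp this with h1 | h1
        · linarith
        · exact absurd h1 h0
    have hfin : (⋃ v ∈ insert a S, {c : ℝ | m v + c • m' v = 0}).Finite :=
      Set.Finite.biUnion (Finset.finite_toSet _) hbad
    obtain ⟨c, hc⟩ := hfin.infinite_compl.nonempty
    refine ⟨m + c • m', K.add_mem hm (K.smul_mem c hm'), ?_⟩
    intro v hv h0
    apply hc
    simp only [Set.mem_iUnion]
    exact ⟨v, hv, h0⟩
end
/-- For an Assur graph with at least two inner vertices, realized with the pins at two or
more distinct locations and the inner vertices generic over the pins, deleting any inner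
vertex `u` (together with all its incident edges) yields a pinned framework with an
infinitesimal motion of all remaining inner vertices: the pinned rigidity matrix of the
resulting pinned graph has a kernel vector which is nonzero at every vertex of
`I ∖ {u}`. -/
theorem assur_vertex_deletion_moves_all {V : Type*} [DecidableEq V]
    (I P : Finset V) (E : Finset (Sym2 V)) (hG : IsPinnedGraph I P E)
    (hPFC : PinnedConditions I P E) (hmin : IsMinimalPinned I P E)
    (hI : 2 ≤ I.card)
    (p : V → ℝ × ℝ) (hpins : ∃ u ∈ P, ∃ w ∈ P, p u ≠ p w)
    (hgen : GenericOverPins I P p) :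
    ∀ u ∈ I, ∃ m : V → ℝ × ℝ,
      IsKernelVector p (I.erase u) (E.filter (fun e => u ∉ sym2Verts e)) m ∧
      ∀ v ∈ I.erase u, m v ≠ 0 := by
  intro u hu
  obtain ⟨g, hg, _⟩ := hpins
  have hS := initial_sparse hG hPFC hmin hg hu
  have hL := laman hG.disj hgen hg _ _ _ rfl (Finset.erase_subset u I) hS
  set F := E.filter (fun e => u ∉ sym2Verts e) with hF
  let K : Submodule ℝ (V → ℝ × ℝ) :=
    { carrier := {m | (∀ v, v ∉ I.erase u → m v = 0) ∧ ∀ e ∈ F, rvL p e m = 0}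
      zero_mem' := ⟨fun _ _ => rfl, fun e _ => map_zero _⟩
      add_mem' := fun {a b} ha hb => ⟨fun v hv => by simp [ha.1 v hv, hb.1 v hv],
        fun e he => by rw [map_add, ha.2 e he, hb.2 e he, add_zero]⟩
      smul_mem' := fun c a ha => ⟨fun v hv => by simp [ha.1 v hv],
        fun e he => by rw [map_smul, ha.2 e he, smul_zero]⟩ }
  obtain ⟨m, hm, hne⟩ := combine K (I.erase u) (by
    intro v hv
    obtain ⟨d, hgood⟩ := hL {v} (by simpa using hv) (by simp)
    obtain ⟨m, h1, h2, h3⟩ := hgood (fun _ => 0) (fun _ => 1)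
    refine ⟨m, ⟨h1, h2⟩, ?_⟩
    intro h0
    have := h3 (v, d) (by simp)
    simp [h0, prj] at this)
  exact ⟨m, ⟨hm.1, fun i j hij => hm.2 s(i, j) hij⟩, hne⟩
end

section
/- Let H(W,Q;F) and G(V,P;E) be pinned graphs satisfying the Pinned Framework Conditions, with W and V disjoint, and let C : Q → V ∪ P be an injective map. The linkage composition C(H,G), obtained by identifying each pinned vertex q of H with its image C(q), is a pinned graph with inner vertex set V ∪ W, pinned vertex set P, and edge set E ∪ F, and it also satisfies the Pinned Framework Conditions. -/
theorem mem_sym2Verts_iff {V : Type*} [DecidableEq V] (e : Sym2 V) (x : V) :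
    x ∈ sym2Verts e ↔ x ∈ e := by
  induction e with
  | _ a b => simp [sym2Verts]

theorem mem_edgeVerts_iff {V : Type*} [DecidableEq V] (F : Finset (Sym2 V)) (x : V) :
    x ∈ edgeVerts F ↔ ∃ e ∈ F, x ∈ e := by
  simp [edgeVerts, Finset.mem_sup, mem_sym2Verts_iff]

theorem sym2_map_injOn {V : Type*} (f : V → V) (S : Set V) (hf : Set.InjOn f S)
    (e e' : Sym2 V) (he : ∀ x ∈ e, x ∈ S) (he' : ∀ x ∈ e', x ∈ S)
    (h : Sym2.map f e = Sym2.map f e') : e = e' := by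
  induction e with
  | _ a b =>
  induction e' with
  | _ x y =>
  simp only [Sym2.mem_iff, forall_eq_or_imp, forall_eq] at he he'
  simp only [Sym2.map_mk, Sym2.eq_iff] at h ⊢
  rcases h with ⟨h1, h2⟩ | ⟨h1, h2⟩
  · exact Or.inl ⟨hf he.1 he'.1 h1, hf he.2 he'.2 h2⟩
  · exact Or.inr ⟨hf he.1 he'.2 h1, hf he.2 he'.1 h2⟩

/-- **Linkage composition.**  Let `H(W,Q;F)` and `G(V,P;E)` be vertex-disjoint pinned
graphs satisfying the Pinned Framework Conditions, and let `c` be a map sending the pins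
`Q` of `H` injectively into `V ∪ P`.  The linkage composition, obtained by identifying
each pin `q ∈ Q` with its image `c q`, is a pinned graph with inner vertices `V ∪ W`,
pins `P`, and edge set `E ∪ F` (with `F` transported along the identification), and it
also satisfies the Pinned Framework Conditions. -/
theorem linkage_composition {T : Type*} [DecidableEq T]
    (W Q V P : Finset T) (F E : Finset (Sym2 T))
    (hH : IsPinnedGraph W Q F) (hHc : PinnedConditions W Q F)
    (hG : IsPinnedGraph V P E) (hGc : PinnedConditions V P E)
    (hWV : Disjoint W V) (hdisj : Disjoint (W ∪ Q) (V ∪ P))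
    (c : T → T) (hc : ∀ q ∈ Q, c q ∈ V ∪ P) (hcinj : Set.InjOn c Q) :
    IsPinnedGraph (V ∪ W) P
      (E ∪ F.image (Sym2.map fun v => if v ∈ Q then c v else v)) ∧
    PinnedConditions (V ∪ W) P
      (E ∪ F.image (Sym2.map fun v => if v ∈ Q then c v else v)) := by
  obtain ⟨f, hf⟩ : ∃ f : T → T, f = fun v => if v ∈ Q then c v else v := ⟨_, rfl⟩
  rw [← hf]
  have hfQ : ∀ q ∈ Q, f q = c q := by intro q hq; simp [hf, hq]
  have hfW : ∀ w ∈ W, f w = w := by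
    intro w hw
    have : w ∉ Q := Finset.disjoint_left.1 hH.disj hw
    simp [hf, this]
  have hWnot : ∀ w ∈ W, w ∉ V ∪ P := fun w hw =>
    Finset.disjoint_left.1 hdisj (Finset.mem_union_left _ hw)
  have hfinj : Set.InjOn f ((W ∪ Q : Finset T) : Set T) := by
    intro x hx y hy hxy
    rw [Finset.mem_coe, Finset.mem_union] at hx hy
    rcases hx with hx | hx <;> rcases hy with hy | hy
    · rwa [hfW x hx, hfW y hy] at hxy
    · rw [hfW x hx, hfQ y hy] at hxy
      exact absurd (hxy ▸ hc y hy) (hWnot x hx)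
    · rw [hfQ x hx, hfW y hy] at hxy
      exact absurd (hxy ▸ hc x hx) (hWnot y hy)
    · rw [hfQ x hx, hfQ y hy] at hxy
      exact hcinj hx hy hxy
  have hFS : ∀ e ∈ F, ∀ x ∈ e, x ∈ W ∪ Q := fun e he x hx =>
    hH.endpoints e he ((mem_sym2Verts_iff e x).2 hx)
  have hES : ∀ e ∈ E, ∀ x ∈ e, x ∈ V ∪ P := fun e he x hx =>
    hG.endpoints e he ((mem_sym2Verts_iff e x).2 hx)
  have hFW : ∀ e ∈ F, ∃ w ∈ W, w ∈ e ∧ w ∈ Sym2.map f e := by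
    intro e he
    obtain ⟨w, hw⟩ := hH.inner e he
    rw [Finset.mem_inter, mem_sym2Verts_iff] at hw
    exact ⟨w, hw.2, hw.1, Sym2.mem_map.2 ⟨w, hw.1, hfW w hw.2⟩⟩
  have hmapinj : Set.InjOn (Sym2.map f) (F : Set (Sym2 T)) := by
    intro e he e' he' h
    exact sym2_map_injOn f _ hfinj e e' (hFS e he) (hFS e' he') h
  have hdisjEF : Disjoint E (F.image (Sym2.map f)) := by
    rw [Finset.disjoint_left]
    intro e he he'
    obtain ⟨e0, he0, rfl⟩ := Finset.mem_image.1 he'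
    obtain ⟨w, hw, _, hwe⟩ := hFW e0 he0
    exact hWnot w hw (hES _ he w hwe)
  refine ⟨⟨?_, ?_, ?_, ?_⟩, ?_, ?_⟩
  · rw [Finset.disjoint_union_left]
    refine ⟨hG.disj, Finset.disjoint_left.2 fun w hw hp => hWnot w hw (Finset.mem_union_right _ hp)⟩
  · intro e he
    rcases Finset.mem_union.1 he with he | he
    · exact hG.not_diag e he
    · obtain ⟨e0, he0, rfl⟩ := Finset.mem_image.1 he
      have h1 := hH.not_diag e0 he0
      have h2 := hFS e0 he0
      induction e0 with
      | _ a b =>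
      simp only [Sym2.mem_iff, forall_eq_or_imp, forall_eq] at h2
      simp only [Sym2.map_mk, Sym2.mk_isDiag_iff] at h1 ⊢
      exact fun h => h1 (hfinj h2.1 h2.2 h)
  · intro e he x hx
    rw [mem_sym2Verts_iff] at hx
    rcases Finset.mem_union.1 he with he | he
    · have := hES e he x hx
      simp only [Finset.mem_union] at this ⊢
      tauto
    · obtain ⟨e0, he0, rfl⟩ := Finset.mem_image.1 he
      obtain ⟨y, hy, rfl⟩ := Sym2.mem_map.1 hx
      rcases Finset.mem_union.1 (hFS e0 he0 y hy) with h | h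
      · rw [hfW y h]; simp [h]
      · rw [hfQ y h]
        have := hc y h
        simp only [Finset.mem_union] at this ⊢
        tauto
  · intro e he
    rcases Finset.mem_union.1 he with he | he
    · obtain ⟨x, hx⟩ := hG.inner e he
      refine ⟨x, ?_⟩
      simp only [Finset.mem_inter, Finset.mem_union] at hx ⊢
      tauto
    · obtain ⟨e0, he0, rfl⟩ := Finset.mem_image.1 he
      obtain ⟨w, hw, _, hwe⟩ := hFW e0 he0
      exact ⟨w, by simp [mem_sym2Verts_iff, hw, -Sym2.mem_map, hwe]⟩
  · rw [Finset.card_union_of_disjoint hdisjEF, Finset.card_image_of_injOn hmapinj,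
      Finset.card_union_of_disjoint hWV.symm, hGc.1, hHc.1]
    ring
  · intro E' hE' hne
    obtain ⟨A, hA⟩ : ∃ A, A = E' ∩ E := ⟨_, rfl⟩
    obtain ⟨B, hB⟩ : ∃ B, B = F.filter (fun e => Sym2.map f e ∈ E') := ⟨_, rfl⟩
    have hAE' : A ⊆ E' := hA ▸ Finset.inter_subset_left
    have hAE : A ⊆ E := hA ▸ Finset.inter_subset_right
    have hBF : B ⊆ F := hB ▸ Finset.filter_subset _ _
    have hBE' : ∀ e ∈ B, Sym2.map f e ∈ E' := by
      intro e he; rw [hB, Finset.mem_filter] at he; exact he.2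
    have hcov : E' ⊆ A ∪ B.image (Sym2.map f) := by
      intro e he
      rcases Finset.mem_union.1 (hE' he) with h | h
      · exact Finset.mem_union_left _ (hA ▸ Finset.mem_inter.2 ⟨he, h⟩)
      · obtain ⟨e0, he0, rfl⟩ := Finset.mem_image.1 h
        exact Finset.mem_union_right _ (Finset.mem_image_of_mem _
          (hB ▸ Finset.mem_filter.2 ⟨he0, he⟩))
    have hcard : E'.card ≤ A.card + B.card :=
      (Finset.card_le_card hcov).trans ((Finset.card_union_le _ _).trans
        (Nat.add_le_add_left Finset.card_image_le _))
    have hvA : edgeVerts A ⊆ edgeVerts E' := by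
      intro x hx
      rw [mem_edgeVerts_iff] at hx ⊢
      obtain ⟨e, he, hx⟩ := hx
      exact ⟨e, hAE' he, hx⟩
    have hvB : ∀ x ∈ edgeVerts B, f x ∈ edgeVerts E' := by
      intro x hx
      rw [mem_edgeVerts_iff] at hx ⊢
      obtain ⟨e, he, hx⟩ := hx
      exact ⟨_, hBE' e he, Sym2.mem_map.2 ⟨x, hx, rfl⟩⟩
    have hVW : (edgeVerts E' ∩ (V ∪ W)).card
        = (edgeVerts E' ∩ V).card + (edgeVerts E' ∩ W).card := by
      rw [Finset.inter_union_distrib_left, Finset.card_union_of_disjoint]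
      exact hWV.symm.mono Finset.inter_subset_right Finset.inter_subset_right
    have h1 : (edgeVerts A ∩ V).card ≤ (edgeVerts E' ∩ V).card :=
      Finset.card_le_card (Finset.inter_subset_inter_right hvA)
    have h2 : (edgeVerts A ∩ P).card ≤ (edgeVerts E' ∩ P).card :=
      Finset.card_le_card (Finset.inter_subset_inter_right hvA)
    have h3 : (edgeVerts B ∩ W).card ≤ (edgeVerts E' ∩ W).card := by
      apply Finset.card_le_card
      intro x hx
      rw [Finset.mem_inter] at hx ⊢
      have := hvB x hx.1
      rw [hfW x hx.2] at this
      exact ⟨this, hx.2⟩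
    have h4 : (edgeVerts B ∩ Q).card ≤ (edgeVerts E' ∩ V).card + (edgeVerts E' ∩ P).card := by
      have hi : Set.InjOn c ((edgeVerts B ∩ Q : Finset T) : Set T) :=
        hcinj.mono (by exact_mod_cast Finset.inter_subset_right)
      rw [← Finset.card_image_of_injOn hi]
      refine (Finset.card_le_card ?_).trans (Finset.card_union_le _ _)
      intro y hy
      obtain ⟨x, hx, rfl⟩ := Finset.mem_image.1 hy
      rw [Finset.mem_inter] at hx
      have := hvB x hx.1
      rw [hfQ x hx.2] at this
      rw [← Finset.inter_union_distrib_left]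
      exact Finset.mem_inter.2 ⟨this, hc x hx.2⟩
    have hEpos := hne.card_pos
    have hA' := hGc.2 A hAE
    have hB' := hHc.2 B hBF
    simp only [← Finset.card_pos, ← Finset.card_eq_zero] at hA' hB' ⊢
    rw [hVW]
    generalize (edgeVerts E' ∩ V).card = v at *
    generalize (edgeVerts E' ∩ W).card = w at *
    generalize (edgeVerts E' ∩ P).card = p at *
    generalize (edgeVerts A ∩ V).card = vA at *
    generalize (edgeVerts A ∩ P).card = pA at *
    generalize (edgeVerts B ∩ W).card = wB at *
    generalize (edgeVerts B ∩ Q).card = q at *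
    generalize E'.card = n at *
    generalize A.card = a at *
    generalize B.card = b at *
    clear hVW
    rcases Nat.eq_zero_or_pos a with ha | ha <;> rcases Nat.eq_zero_or_pos b with hb | hb
    · omega
    · have hB'' := hB' hb
      clear hA' hB'
      omega
    · have hA'' := hA' ha
      clear hA' hB'
      omega
    · have hA'' := hA' ha
      have hB'' := hB' hb
      clear hA' hB'
      omega
end

section
/- Every pinned graph G(I,P;E) satisfying the Pinned Framework Conditions with I ≠ ∅ contains an Assur graph as a subgraph whose pins lie in P: there exist a nonempty set I' ⊆ I, a set P' ⊆ P with |P'| ≥ 2, and a set E' ⊆ E of edges with both endpoints in I' ∪ P' and at least one endpoint in I', such that the pinned graph G'(I',P';E') is an Assur graph. -/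
theorem aux_edgeVerts_subset {V : Type*} [DecidableEq V] {F : Finset (Sym2 V)} {S : Finset V}
    (h : ∀ e ∈ F, sym2Verts e ⊆ S) : edgeVerts F ⊆ S :=
  Finset.sup_le h

theorem aux_inter_eq {V : Type*} [DecidableEq V] {I P I' P' : Finset V} {X : Finset V}
    (hd : Disjoint I P) (hI : I' ⊆ I) (hP : P' ⊆ P) (hX : X ⊆ I' ∪ P') :
    X ∩ I = X ∩ I' ∧ X ∩ P = X ∩ P' := by
  rw [Finset.disjoint_left] at hd
  constructor
  · ext v
    have := @hX v
    have := @hd v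
    have := @hI v
    have := @hP v
    simp only [Finset.mem_inter, Finset.mem_union] at *
    tauto
  · ext v
    have := @hX v
    have := @hd v
    have := @hI v
    have := @hP v
    simp only [Finset.mem_inter, Finset.mem_union] at *
    tauto

/-- Every pinned graph satisfying the Pinned Framework Conditions with at least one inner
vertex contains an Assur graph as a subgraph whose pins lie in `P`: there are a nonempty
`I' ⊆ I`, a set `P' ⊆ P` with `|P'| ≥ 2`, and a set `E' ⊆ E` of edges with both
endpoints in `I' ∪ P'` and at least one endpoint in `I'`, such that the pinned graph
`G'(I',P';E')` is an Assur graph (it satisfies the Pinned Framework Conditions and is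
minimal). -/
theorem exists_assur_subgraph {V : Type*} [DecidableEq V]
    (I P : Finset V) (E : Finset (Sym2 V)) (hG : IsPinnedGraph I P E)
    (hPFC : PinnedConditions I P E) (hI : I.Nonempty) :
    ∃ (I' P' : Finset V) (E' : Finset (Sym2 V)),
      I' ⊆ I ∧ I'.Nonempty ∧ P' ⊆ P ∧ 2 ≤ P'.card ∧ E' ⊆ E ∧
      (∀ e ∈ E', sym2Verts e ⊆ I' ∪ P' ∧ (sym2Verts e ∩ I').Nonempty) ∧
      IsPinnedGraph I' P' E' ∧ PinnedConditions I' P' E' ∧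
      IsMinimalPinned I' P' E' := by
  classical
  obtain ⟨hcard, hcond⟩ := hPFC
  let S := (I.powerset ×ˢ P.powerset).filter
    (fun q => q.1.Nonempty ∧ 2 * q.1.card ≤ (inducedEdges q.1 q.2 E).card)
  have hS : S.Nonempty := by
    refine ⟨(I, P), ?_⟩
    have : inducedEdges I P E = E :=
      Finset.filter_true_of_mem fun e he => ⟨hG.endpoints e he, hG.inner e he⟩
    simp [S, hI, this, hcard]
  obtain ⟨⟨I', P'⟩, hmem, hmin⟩ := S.exists_min_image (fun q => q.1.card + q.2.card) hS
  simp only [S, Finset.mem_filter, Finset.mem_product, Finset.mem_powerset] at hmem hmin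
  obtain ⟨⟨hI', hP'⟩, hne, hge⟩ := hmem
  have hsub : inducedEdges I' P' E ⊆ E := Finset.filter_subset _ _
  have hprop : ∀ e ∈ inducedEdges I' P' E,
      sym2Verts e ⊆ I' ∪ P' ∧ (sym2Verts e ∩ I').Nonempty :=
    fun e he => (Finset.mem_filter.1 he).2
  have hd' : Disjoint I' P' := Finset.disjoint_of_subset_left hI'
    (Finset.disjoint_of_subset_right hP' hG.disj)
  have hcond' : ∀ F ⊆ inducedEdges I' P' E, F.Nonempty →
      (2 ≤ (edgeVerts F ∩ P').card → F.card ≤ 2 * (edgeVerts F ∩ I').card) ∧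
      ((edgeVerts F ∩ P').card = 1 → F.card ≤ 2 * (edgeVerts F ∩ I').card - 1) ∧
      (edgeVerts F ∩ P' = ∅ → F.card ≤ 2 * (edgeVerts F ∩ I').card - 3) := by
    intro F hF hFne
    have hX : edgeVerts F ⊆ I' ∪ P' := aux_edgeVerts_subset fun e he => (hprop e (hF he)).1
    obtain ⟨h1, h2⟩ := aux_inter_eq hG.disj hI' hP' hX
    rw [← h1, ← h2]
    exact hcond F (hF.trans hsub) hFne
  have hpos : 0 < I'.card := hne.card_pos
  have hEne : (inducedEdges I' P' E).Nonempty := Finset.card_pos.1 (by omega)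
  obtain ⟨c2, c1, c0⟩ := hcond' _ subset_rfl hEne
  have hle1 : (edgeVerts (inducedEdges I' P' E) ∩ I').card ≤ I'.card :=
    Finset.card_le_card Finset.inter_subset_right
  have hle2 : (edgeVerts (inducedEdges I' P' E) ∩ P').card ≤ P'.card :=
    Finset.card_le_card Finset.inter_subset_right
  rw [← Finset.card_eq_zero] at c0
  refine ⟨I', P', inducedEdges I' P' E, hI', hne, hP', by omega, hsub, hprop,
    ⟨hd', fun e he => hG.not_diag e (hsub he), fun e he => (hprop e he).1,
      fun e he => (hprop e he).2⟩, ⟨by omega, hcond'⟩, ?_⟩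
  intro J hJ Q hQ hlt
  have hlt' := Finset.card_lt_card hlt
  rw [Finset.card_union_of_disjoint hd', Finset.card_union_of_disjoint
    (Finset.disjoint_of_subset_left hJ (Finset.disjoint_of_subset_right hQ hd'))] at hlt'
  rcases J.eq_empty_or_nonempty with rfl | hJne
  · simp [inducedEdges]
  · have hle : (inducedEdges J Q (inducedEdges I' P' E)).card ≤ (inducedEdges J Q E).card :=
      Finset.card_le_card (Finset.filter_subset_filter _ hsub)
    by_contra hcon
    have := hmin (J, Q) ⟨⟨hJ.trans hI', hQ.trans hP'⟩, hJne, by dsimp only; omega⟩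
    dsimp only at this
    omega
end

section
/- Let C be a rigidity circuit, let e = {u,w} ∈ C, let v be a new vertex not in V(C), and let x ∈ V(C) ∖ {u,w}. Then the edge set (C ∖ {e}) ∪ {{v,u}, {v,w}, {v,x}} obtained by the edge-split operation is again a rigidity circuit. -/
/-- An edge set `C` is a rigidity circuit if `|C| = 2|V(C)| - 2` and every proper
nonempty subset `F ⊊ C` satisfies Laman's condition `|F| ≤ 2|V(F)| - 3`. -/
def IsCircuit {V : Type*} [DecidableEq V] (C : Finset (Sym2 V)) : Prop :=
  C.card = 2 * (edgeVerts C).card - 2 ∧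
  ∀ F ⊆ C, F.Nonempty → F ≠ C → F.card ≤ 2 * (edgeVerts F).card - 3

theorem es_mem_edgeVerts {V : Type*} [DecidableEq V] (F : Finset (Sym2 V)) (a : V) :
    a ∈ edgeVerts F ↔ ∃ b, s(a, b) ∈ F := by
  have key : ∀ e : Sym2 V, a ∈ sym2Verts e ↔ a ∈ e := by
    intro e
    induction e using Sym2.ind with
    | _ p q => simp [sym2Verts]
  unfold edgeVerts
  rw [Finset.mem_sup]
  constructor
  · rintro ⟨e, he, ha⟩
    rw [key] at ha
    obtain ⟨b, rfl⟩ := ha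
    exact ⟨b, he⟩
  · rintro ⟨b, hb⟩
    exact ⟨_, hb, (key _).2 (Sym2.mem_mk_left a b)⟩

theorem es_mem_right {V : Type*} [DecidableEq V] {F : Finset (Sym2 V)} {a b : V}
    (h : s(a, b) ∈ F) : b ∈ edgeVerts F :=
  (es_mem_edgeVerts F b).2 ⟨a, by rwa [Sym2.eq_swap]⟩

theorem es_mem_left {V : Type*} [DecidableEq V] {F : Finset (Sym2 V)} {a b : V}
    (h : s(a, b) ∈ F) : a ∈ edgeVerts F :=
  (es_mem_edgeVerts F a).2 ⟨b, h⟩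

theorem es_mono {V : Type*} [DecidableEq V] {F G : Finset (Sym2 V)} (h : F ⊆ G) :
    edgeVerts F ⊆ edgeVerts G := Finset.sup_mono h

/-- **Edge-split preserves rigidity circuits.**  If `C` is a rigidity circuit,
`e = {u,w} ∈ C`, `v` is a new vertex not in `V(C)`, and `x ∈ V(C) ∖ {u,w}`, then the
edge set `(C ∖ {e}) ∪ {{v,u}, {v,w}, {v,x}}` is again a rigidity circuit. -/
theorem edge_split_circuit {V : Type*} [DecidableEq V] (C : Finset (Sym2 V))
    (hC : IsCircuit C) (u w v x : V) (he : s(u, w) ∈ C)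
    (hv : v ∉ edgeVerts C) (hx : x ∈ edgeVerts C) (hxu : x ≠ u) (hxw : x ≠ w) :
    IsCircuit ((C.erase s(u, w)) ∪ {s(v, u), s(v, w), s(v, x)}) := by
  obtain ⟨hcard, hsub⟩ := hC
  have hCpos : 0 < C.card := Finset.card_pos.2 ⟨_, he⟩
  have huC := es_mem_left he
  have hwC := es_mem_right he
  have hvert1 : ∀ a : V, edgeVerts {s(a, a)} = {a} := by
    intro a; simp [edgeVerts, sym2Verts]
  have huw : u ≠ w := by
    rintro rfl
    by_cases h : {s(u, u)} = C
    · rw [← h, hvert1] at hcard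
      simp at hcard
    · have := hsub {s(u, u)} (by simpa using he) (by simp) h
      rw [hvert1] at this
      simp at this
  have hvC : ∀ a, s(v, a) ∉ C := fun a h => hv (es_mem_left h)
  have hinj : Function.Injective (fun a : V => s(v, a)) := by
    intro a b h
    rcases Sym2.eq_iff.1 h with ⟨_, h2⟩ | ⟨h1, h2⟩
    · exact h2
    · exact h2.trans h1
  have himg : ({s(v, u), s(v, w), s(v, x)} : Finset (Sym2 V))
      = ({u, w, x} : Finset V).image (fun a => s(v, a)) := by
    simp [Finset.image_insert]
  have h3 : ({u, w, x} : Finset V).card = 3 := by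
    rw [Finset.card_eq_three]
    exact ⟨u, w, x, huw, hxu.symm, hxw.symm, rfl⟩
  rw [himg]
  -- cardinality of unions
  have hun : ∀ (F : Finset (Sym2 V)) (A : Finset V), F ⊆ C →
      (F ∪ A.image (fun a => s(v, a))).card = F.card + A.card := by
    intro F A hF
    rw [Finset.card_union_of_disjoint, Finset.card_image_of_injective _ hinj]
    rw [Finset.disjoint_left]
    intro e heF heA
    obtain ⟨a, _, rfl⟩ := Finset.mem_image.1 heA
    exact hvC a (hF heF)
  constructor
  · have hV : edgeVerts (C.erase s(u, w) ∪ ({u, w, x} : Finset V).image (fun a => s(v, a)))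
        = insert v (edgeVerts C) := by
      ext a
      rw [Finset.mem_insert]
      constructor
      · intro h
        obtain ⟨b, hb⟩ := (es_mem_edgeVerts _ _).1 h
        rcases Finset.mem_union.1 hb with hb | hb
        · exact Or.inr (es_mem_left (Finset.mem_of_mem_erase hb))
        · obtain ⟨c, hc, hcb⟩ := Finset.mem_image.1 hb
          have hcC : c ∈ edgeVerts C := by
            simp only [Finset.mem_insert, Finset.mem_singleton] at hc
            rcases hc with rfl | rfl | rfl <;> assumption
          rcases Sym2.eq_iff.1 hcb with ⟨h1, h2⟩ | ⟨h1, h2⟩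
          · exact Or.inl h1.symm
          · exact Or.inr (h2 ▸ hcC)
      · intro h
        have hnew : ∀ c ∈ ({u, w, x} : Finset V), s(v, c) ∈
            C.erase s(u, w) ∪ ({u, w, x} : Finset V).image (fun a => s(v, a)) :=
          fun c hc => Finset.mem_union_right _ (Finset.mem_image_of_mem _ hc)
        rcases h with rfl | h
        · exact es_mem_left (hnew u (by simp))
        · by_cases hau : a = u
          · subst hau; exact es_mem_right (hnew a (by simp))
          by_cases haw : a = w
          · subst haw; exact es_mem_right (hnew a (by simp))
          obtain ⟨b, hb⟩ := (es_mem_edgeVerts _ _).1 h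
          refine es_mem_left (b := b) (Finset.mem_union_left _ (Finset.mem_erase.2 ⟨?_, hb⟩))
          intro hh
          rcases Sym2.eq_iff.1 hh with ⟨h1, _⟩ | ⟨h1, _⟩
          · exact hau h1
          · exact haw h1
    rw [hV, Finset.card_insert_of_notMem hv, hun _ _ (Finset.erase_subset _ _), h3,
      Finset.card_erase_of_mem he]
    omega
  · intro F hF hFne hFC
    obtain ⟨F0, hF0⟩ : ∃ F0, F0 = F ∩ C.erase s(u, w) := ⟨_, rfl⟩
    obtain ⟨A, hA⟩ : ∃ A, A = ({u, w, x} : Finset V).filter (fun a => s(v, a) ∈ F) := ⟨_, rfl⟩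
    have hAsub : A ⊆ {u, w, x} := hA ▸ Finset.filter_subset _ _
    have hF0e : F0 ⊆ C.erase s(u, w) := hF0 ▸ Finset.inter_subset_right
    have hF0C : F0 ⊆ C := hF0e.trans (Finset.erase_subset _ _)
    have hF0F : F0 ⊆ F := hF0 ▸ Finset.inter_subset_left
    have heF0 : s(u, w) ∉ F0 := fun h => Finset.notMem_erase _ _ (hF0e h)
    have hAF : ∀ a ∈ A, s(v, a) ∈ F := by
      intro a ha; rw [hA] at ha; exact (Finset.mem_filter.1 ha).2
    have hFeq : F = F0 ∪ A.image (fun a => s(v, a)) := by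
      apply Finset.Subset.antisymm
      · intro e heF
        rcases Finset.mem_union.1 (hF heF) with h | h
        · exact Finset.mem_union_left _ (hF0 ▸ Finset.mem_inter.2 ⟨heF, h⟩)
        · obtain ⟨a, ha, rfl⟩ := Finset.mem_image.1 h
          exact Finset.mem_union_right _ (Finset.mem_image_of_mem _
            (hA ▸ Finset.mem_filter.2 ⟨ha, heF⟩))
      · apply Finset.union_subset hF0F
        intro e h
        obtain ⟨a, ha, rfl⟩ := Finset.mem_image.1 h
        exact hAF a ha
    have hFcard : F.card = F0.card + A.card := by rw [hFeq]; exact hun _ _ hF0C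
    have hvF0 : v ∉ edgeVerts F0 := fun h => hv (es_mono hF0C h)
    have hA3 : A.card ≤ 3 := h3 ▸ Finset.card_le_card hAsub
    have hF0ne : F0 ≠ C := fun h => heF0 (h ▸ he)
    have hF0lam : F0.Nonempty → F0.card ≤ 2 * (edgeVerts F0).card - 3 :=
      fun h => hsub F0 hF0C h hF0ne
    have hF0pos : F0.Nonempty → 0 < F0.card := Finset.card_pos.2
    rcases A.eq_empty_or_nonempty with hAe | ⟨a0, ha0⟩
    · have : F = F0 := by rw [hFeq, hAe]; simp
      rw [this]
      exact hF0lam (this ▸ hFne)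
    have hvF : v ∈ edgeVerts F := es_mem_left (hAF a0 ha0)
    have hAV : A ⊆ edgeVerts F := fun a ha => es_mem_right (hAF a ha)
    have hApos : 0 < A.card := Finset.card_pos.2 ⟨a0, ha0⟩
    by_cases hk : A.card = 3
    · have hAeq : A = {u, w, x} := Finset.eq_of_subset_of_card_le hAsub (by omega)
      have hne : insert s(u, w) F0 ≠ C := by
        intro h
        apply hFC
        rw [hFeq, hAeq, ← h, Finset.erase_insert heF0]
      have hl := hsub (insert s(u, w) F0) (Finset.insert_subset he hF0C)
        (Finset.insert_nonempty _ _) hne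
      rw [Finset.card_insert_of_notMem heF0] at hl
      have hss : insert v (edgeVerts (insert s(u, w) F0)) ⊆ edgeVerts F := by
        apply Finset.insert_subset hvF
        intro a ha
        obtain ⟨b, hb⟩ := (es_mem_edgeVerts _ _).1 ha
        rcases Finset.mem_insert.1 hb with hb | hb
        · apply hAV
          rw [hAeq]
          rcases Sym2.eq_iff.1 hb with ⟨h1, _⟩ | ⟨h1, _⟩ <;> simp [h1]
        · exact es_mem_left (hF0F hb)
      have hle := Finset.card_le_card hss
      rw [Finset.card_insert_of_notMem
        (fun h => hv (es_mono (Finset.insert_subset he hF0C) h))] at hle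
      omega
    · rcases F0.eq_empty_or_nonempty with h0 | h0
      · have hvA : v ∉ A := by
          intro h
          have := hAsub h
          simp only [Finset.mem_insert, Finset.mem_singleton] at this
          rcases this with h | h | h <;> rw [h] at hv <;> contradiction
        have hle := Finset.card_le_card (Finset.insert_subset hvF hAV)
        rw [Finset.card_insert_of_notMem hvA] at hle
        have : F0.card = 0 := by simp [h0]
        omega
      · have hle := Finset.card_le_card (Finset.insert_subset hvF (es_mono hF0F))
        rw [Finset.card_insert_of_notMem hvF0] at hle
        have := hF0lam h0
        have := hF0pos h0
        omega
end

section
/- Let G(I,P;E) be a pinned graph satisfying the Pinned Framework Conditions with |I| ≥ 2. Then: (a) at least three edges of E have one endpoint in I and the other in P; and (b) there exists an inner vertex of valence at most 3 (i.e., incident to at most 3 edges of E). -/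
/-- For a pinned graph satisfying the Pinned Framework Conditions with at least two inner
vertices: (a) at least three edges join an inner vertex to a pinned vertex, and (b) some
inner vertex is incident to at most three edges. -/
theorem pinned_edges_and_low_valence {V : Type*} [DecidableEq V]
    (I P : Finset V) (E : Finset (Sym2 V)) (hG : IsPinnedGraph I P E)
    (hPFC : PinnedConditions I P E) (hI : 2 ≤ I.card) :
    3 ≤ (E.filter (fun e => ∃ i ∈ I, ∃ j ∈ P, e = s(i, j))).card ∧
    ∃ v ∈ I, (E.filter (fun e => v ∈ sym2Verts e)).card ≤ 3 := by
  have hpair : ∀ a b : V, sym2Verts s(a, b) = {a, b} := fun a b => rfl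
  have hdisj : ∀ x, x ∈ I → x ∈ P → False := fun x h1 h2 =>
    Finset.disjoint_left.mp hG.disj h1 h2
  have ha : 3 ≤ (E.filter (fun e => ∃ i ∈ I, ∃ j ∈ P, e = s(i, j))).card := by
    have hsplit := Finset.card_filter_add_card_filter_not (s := E)
      (fun e => ∃ i ∈ I, ∃ j ∈ P, e = s(i, j))
    have hE := hPFC.1
    by_cases hne : (E.filter (fun e => ¬ ∃ i ∈ I, ∃ j ∈ P, e = s(i, j))).Nonempty
    · have h := (hPFC.2 _ (Finset.filter_subset _ _) hne).2.2 (by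
        rw [Finset.eq_empty_iff_forall_notMem]
        intro x hx
        rw [Finset.mem_inter, edgeVerts, Finset.mem_sup] at hx
        obtain ⟨⟨e, he, hxe⟩, hxP⟩ := hx
        rw [Finset.mem_filter] at he
        obtain ⟨heE, hno⟩ := he
        obtain ⟨y, hy⟩ := hG.inner e heE
        induction e using Sym2.ind with
        | _ a b =>
          simp only [hpair, Finset.mem_inter, Finset.mem_insert, Finset.mem_singleton] at hxe hy
          obtain ⟨hy, hyI⟩ := hy
          apply hno
          rcases hxe with rfl | rfl <;> rcases hy with rfl | rfl
          · exact (hdisj _ hyI hxP).elim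
          · exact ⟨_, hyI, _, hxP, Sym2.eq_swap⟩
          · exact ⟨_, hyI, _, hxP, rfl⟩
          · exact (hdisj _ hyI hxP).elim)
      have hle := Finset.card_le_card (Finset.inter_subset_right
        (s₁ := edgeVerts (E.filter (fun e => ¬ ∃ i ∈ I, ∃ j ∈ P, e = s(i, j)))) (s₂ := I))
      omega
    · rw [Finset.not_nonempty_iff_eq_empty] at hne
      rw [hne, Finset.card_empty] at hsplit
      omega
  refine ⟨ha, ?_⟩
  by_contra! hcon
  have h1 : I.card * 4 ≤ ∑ v ∈ I, (E.filter (fun e => v ∈ sym2Verts e)).card := by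
    rw [← smul_eq_mul]
    exact Finset.card_nsmul_le_sum _ _ _ (fun v hv => hcon v hv)
  have h2 := Finset.sum_card_bipartiteAbove_eq_sum_card_bipartiteBelow (s := I) (t := E)
    (fun v e => v ∈ sym2Verts e)
  simp only [Finset.bipartiteAbove, Finset.bipartiteBelow] at h2
  have h3 : ∑ e ∈ E, (I.filter (fun v => v ∈ sym2Verts e)).card < ∑ e ∈ E, 2 := by
    apply Finset.sum_lt_sum
    · intro e _
      induction e using Sym2.ind with
      | _ a b =>
        exact (Finset.card_le_card (fun x hx => (Finset.mem_filter.mp hx).2)).trans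
          Finset.card_le_two
    · obtain ⟨e, he⟩ := Finset.card_pos.mp (by omega : 0 <
        (E.filter (fun e => ∃ i ∈ I, ∃ j ∈ P, e = s(i, j))).card)
      rw [Finset.mem_filter] at he
      obtain ⟨heE, i, hi, j, hj, rfl⟩ := he
      refine ⟨_, heE, ?_⟩
      have : I.filter (fun v => v ∈ sym2Verts s(i, j)) ⊆ {i} := by
        intro x hx
        rw [Finset.mem_filter, hpair, Finset.mem_insert, Finset.mem_singleton] at hx
        rcases hx with ⟨hxI, rfl | rfl⟩
        · simp
        · exact (hdisj _ hxI hj).elim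
      have := Finset.card_le_card this
      rw [Finset.card_singleton] at this
      omega
  rw [Finset.sum_const, smul_eq_mul, hPFC.1] at h3
  omega
end

section
/- Let E be an edge set of a finite graph satisfying Laman's condition, let v be a new vertex not in V(E), and let u, w be two distinct vertices of V(E). Then E ∪ {{v,u}, {v,w}} also satisfies Laman's condition. -/
/-- Laman's condition: every nonempty subset `F'` of the edge set `F`
satisfies `|F'| ≤ 2|V(F')| - 3`. -/
def Laman {V : Type*} [DecidableEq V] (F : Finset (Sym2 V)) : Prop :=
  ∀ F' ⊆ F, F'.Nonempty → F'.card ≤ 2 * (edgeVerts F').card - 3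

/-- **2-valent vertex addition preserves Laman's condition.**  If `E` satisfies Laman's
condition, `v` is a new vertex not in `V(E)`, and `u, w` are two distinct vertices of
`V(E)`, then `E ∪ {{v,u}, {v,w}}` also satisfies Laman's condition. -/
theorem vertex_addition_laman {V : Type*} [DecidableEq V] (E : Finset (Sym2 V))
    (hE : Laman E) (v u w : V) (hv : v ∉ edgeVerts E)
    (hu : u ∈ edgeVerts E) (hw : w ∈ edgeVerts E) (huw : u ≠ w) :
    Laman (E ∪ {s(v, u), s(v, w)}) := by
  have hmem : ∀ (F : Finset (Sym2 V)) (x : V), x ∈ edgeVerts F ↔ ∃ e ∈ F, x ∈ sym2Verts e := by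
    intro F x
    simp [edgeVerts, Finset.mem_sup]
  have hs : ∀ a b x : V, x ∈ sym2Verts s(a, b) ↔ x = a ∨ x = b := by
    intro a b x
    simp [sym2Verts]
  have hvu : v ≠ u := fun h => hv (h ▸ hu)
  have hvw : v ≠ w := fun h => hv (h ▸ hw)
  intro F hF hne
  by_cases hFE : F ⊆ E
  · exact hE F hFE hne
  obtain ⟨e, heF, heE⟩ := Finset.not_subset.mp hFE
  have he : ∃ x, (x = u ∨ x = w) ∧ e = s(v, x) := by
    have := hF heF
    simp only [Finset.mem_union, Finset.mem_insert, Finset.mem_singleton] at this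
    rcases this with h | h | h
    · exact absurd h heE
    · exact ⟨u, Or.inl rfl, h⟩
    · exact ⟨w, Or.inr rfl, h⟩
  obtain ⟨x, hx, rfl⟩ := he
  have hvF : v ∈ edgeVerts F := (hmem F v).2 ⟨_, heF, (hs _ _ _).2 (Or.inl rfl)⟩
  have hxF : x ∈ edgeVerts F := (hmem F x).2 ⟨_, heF, (hs _ _ _).2 (Or.inr rfl)⟩
  have hcard : F.card ≤ (F ∩ E).card + 2 := by
    have h1 : F ⊆ (F ∩ E) ∪ {s(v, u), s(v, w)} := by
      intro y hy
      have := hF hy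
      simp only [Finset.mem_union, Finset.mem_inter] at this ⊢
      tauto
    have h2 := Finset.card_le_card h1
    have h3 := Finset.card_union_le (F ∩ E) {s(v, u), s(v, w)}
    have h4 : ({s(v, u), s(v, w)} : Finset (Sym2 V)).card ≤ 2 := Finset.card_le_two
    omega
  by_cases hG : (F ∩ E).Nonempty
  · have h1 := hE _ Finset.inter_subset_right hG
    have h2 := hG.card_pos
    have hvG : v ∉ edgeVerts (F ∩ E) := by
      intro h
      obtain ⟨e, h, h'⟩ := (hmem _ _).1 h
      exact hv ((hmem _ _).2 ⟨e, (Finset.mem_inter.1 h).2, h'⟩)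
    have h3 : insert v (edgeVerts (F ∩ E)) ⊆ edgeVerts F := by
      intro y hy
      rcases Finset.mem_insert.1 hy with rfl | h
      · exact hvF
      · obtain ⟨e, h, h'⟩ := (hmem _ _).1 h
        exact (hmem _ _).2 ⟨e, (Finset.mem_inter.1 h).1, h'⟩
    have h4 := Finset.card_le_card h3
    rw [Finset.card_insert_of_notMem hvG] at h4
    omega
  · rw [Finset.not_nonempty_iff_eq_empty] at hG
    rw [hG, Finset.card_empty] at hcard
    have hvx : v ≠ x := by rcases hx with rfl | rfl <;> assumption
    by_cases hb : s(v, u) ∈ F ∧ s(v, w) ∈ F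
    · have h3 : ({v, u, w} : Finset V) ⊆ edgeVerts F := by
        intro y hy
        simp only [Finset.mem_insert, Finset.mem_singleton] at hy
        rcases hy with rfl | rfl | rfl
        · exact hvF
        · exact (hmem _ _).2 ⟨_, hb.1, (hs _ _ _).2 (Or.inr rfl)⟩
        · exact (hmem _ _).2 ⟨_, hb.2, (hs _ _ _).2 (Or.inr rfl)⟩
      have h4 := Finset.card_le_card h3
      rw [Finset.card_eq_three.2 ⟨v, u, w, hvu, hvw, huw, rfl⟩] at h4
      omega
    · have h1 : F.card ≤ 1 := by
        rw [Finset.card_le_one]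
        have key : ∀ a ∈ F, a = s(v, u) ∨ a = s(v, w) := by
          intro a ha
          have := hF ha
          simp only [Finset.mem_union, Finset.mem_insert, Finset.mem_singleton] at this
          rcases this with h | h
          · have : a ∈ F ∩ E := Finset.mem_inter.2 ⟨ha, h⟩
            rw [hG] at this
            simp at this
          · exact h
        intro a ha b hb'
        rcases key a ha with rfl | rfl <;> rcases key b hb' with rfl | rfl
        · rfl
        · exact absurd ⟨ha, hb'⟩ hb
        · exact absurd ⟨hb', ha⟩ hb
        · rfl
      have h3 : ({v, x} : Finset V) ⊆ edgeVerts F := by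
        intro y hy
        simp only [Finset.mem_insert, Finset.mem_singleton] at hy
        rcases hy with rfl | rfl <;> assumption
      have h4 := Finset.card_le_card h3
      rw [Finset.card_pair hvx] at h4
      omega
end

section
/- Let q₁, …, q_m ∈ ℝ² (m ≥ 2) and q₀ ∈ ℝ² be points such that for each i = 1, …, m−1 the three points q₀, q_i, q_{i+1} are not collinear. Then the framework consisting of the path edges {q_i, q_{i+1}} for i = 1, …, m−1 together with the cone edges {q₀, q_i} for i = 1, …, m (a string of non-collinear triangles) is infinitesimally rigid in the plane: its rigidity matrix has rank 2(m+1) − 3, equivalently every kernel vector of the rigidity matrix is a trivial infinitesimal motion (the restriction of an infinitesimal translation or rotation of ℝ²). -/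
/-- The counterclockwise rotation of a plane vector by a quarter turn:
`(x, y)ᵖᵉʳᵖ = (-y, x)`. -/
def perp (a : ℝ × ℝ) : ℝ × ℝ := (-a.2, a.1)

/-- Three points of the plane with vanishing determinant are collinear. -/
lemma collinear_of_det_eq_zero (o x y : ℝ × ℝ)
    (h : (x.1 - o.1) * (y.2 - o.2) - (x.2 - o.2) * (y.1 - o.1) = 0) :
    Collinear ℝ ({o, x, y} : Set (ℝ × ℝ)) := by
  rw [collinear_iff_of_mem (p₀ := o) (by simp)]
  by_cases hx : x = o
  · refine ⟨y - o, ?_⟩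
    intro q hq
    simp only [Set.mem_insert_iff, Set.mem_singleton_iff] at hq
    rcases hq with rfl | rfl | rfl
    · exact ⟨0, by simp⟩
    · exact ⟨0, by simp [hx]⟩
    · exact ⟨1, by simp⟩
  · refine ⟨x - o, ?_⟩
    intro q hq
    simp only [Set.mem_insert_iff, Set.mem_singleton_iff] at hq
    rcases hq with rfl | rfl | rfl
    · exact ⟨0, by simp⟩
    · exact ⟨1, by simp⟩
    · by_cases h1 : x.1 - o.1 = 0
      · have h2 : x.2 - o.2 ≠ 0 := fun h2 =>
          hx (Prod.ext (sub_eq_zero.mp h1) (sub_eq_zero.mp h2))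
        refine ⟨(q.2 - o.2) / (x.2 - o.2), Prod.ext ?_ ?_⟩
        · simp only [vadd_eq_add, Prod.fst_add, Prod.smul_fst, Prod.fst_sub, smul_eq_mul]
          field_simp
          linarith
        · simp only [vadd_eq_add, Prod.snd_add, Prod.smul_snd, Prod.snd_sub, smul_eq_mul]
          field_simp
          ring
      · refine ⟨(q.1 - o.1) / (x.1 - o.1), Prod.ext ?_ ?_⟩
        · simp only [vadd_eq_add, Prod.fst_add, Prod.smul_fst, Prod.fst_sub, smul_eq_mul]
          field_simp
          ring
        · simp only [vadd_eq_add, Prod.snd_add, Prod.smul_snd, Prod.snd_sub, smul_eq_mul]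
          field_simp
          linarith

/-- A vector orthogonal to a nonzero vector is a multiple of its quarter turn. -/
lemma exists_rotation (o x n k : ℝ × ℝ) (hx : x ≠ o) (h : dot (o - x) (n - k) = 0) :
    ∃ b : ℝ, k = n + b • perp (x - o) := by
  simp only [dot, Prod.fst_sub, Prod.snd_sub] at h
  by_cases h1 : x.1 - o.1 = 0
  · have h2 : x.2 - o.2 ≠ 0 := fun h2 =>
      hx (Prod.ext (sub_eq_zero.mp h1) (sub_eq_zero.mp h2))
    refine ⟨-(k.1 - n.1) / (x.2 - o.2), Prod.ext ?_ ?_⟩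
    · simp only [perp, Prod.fst_add, Prod.smul_fst, Prod.snd_sub, smul_eq_mul]
      field_simp
      ring
    · simp only [perp, Prod.snd_add, Prod.smul_snd, Prod.fst_sub, smul_eq_mul]
      field_simp
      linarith
  · refine ⟨(k.2 - n.2) / (x.1 - o.1), Prod.ext ?_ ?_⟩
    · simp only [perp, Prod.fst_add, Prod.smul_fst, Prod.snd_sub, smul_eq_mul]
      field_simp
      linarith
    · simp only [perp, Prod.snd_add, Prod.smul_snd, Prod.fst_sub, smul_eq_mul]
      field_simp
      ring

/-- The rotation rate propagates across a non-degenerate triangle. -/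
lemma rotation_step (o x y n k l : ℝ × ℝ) (b : ℝ)
    (hc : ¬ Collinear ℝ ({o, x, y} : Set (ℝ × ℝ)))
    (hk : k = n + b • perp (x - o)) (hxy : dot (x - y) (k - l) = 0)
    (hoy : dot (o - y) (n - l) = 0) : l = n + b • perp (y - o) := by
  have hd := mt (collinear_of_det_eq_zero o x y) hc
  subst hk
  simp only [dot, perp, Prod.fst_sub, Prod.snd_sub, Prod.fst_add, Prod.snd_add,
    Prod.smul_fst, Prod.smul_snd, smul_eq_mul] at hxy hoy
  -- the discrepancy `w` is orthogonal to both `x - o` and `y - o`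
  obtain ⟨w1, hw1⟩ : ∃ w1, w1 = l.1 - n.1 + b * (y.2 - o.2) := ⟨_, rfl⟩
  obtain ⟨w2, hw2⟩ : ∃ w2, w2 = l.2 - n.2 - b * (y.1 - o.1) := ⟨_, rfl⟩
  have e1 : (y.1 - o.1) * w1 + (y.2 - o.2) * w2 = 0 := by
    rw [hw1, hw2]; linear_combination hoy
  have e2 : (x.1 - o.1) * w1 + (x.2 - o.2) * w2 = 0 := by
    rw [hw1, hw2]; linear_combination hoy - hxy
  have z1 : w1 = 0 := (mul_eq_zero.mp (show _ * w1 = 0 by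
    linear_combination (y.2 - o.2) * e2 - (x.2 - o.2) * e1)).resolve_left hd
  have z2 : w2 = 0 := (mul_eq_zero.mp (show _ * w2 = 0 by
    linear_combination (x.1 - o.1) * e1 - (y.1 - o.1) * e2)).resolve_left hd
  refine Prod.ext ?_ ?_
  · simp only [perp, Prod.fst_add, Prod.smul_fst, Prod.snd_sub, smul_eq_mul]
    linarith
  · simp only [perp, Prod.snd_add, Prod.smul_snd, Prod.fst_sub, smul_eq_mul]
    linarith

/-- **A string of non-collinear triangles is infinitesimally rigid.**  Let
`p 0 = q₀` and `p 1, …, p m` (for `m ≥ 2`) be points of `ℝ²` such that `q₀, qᵢ, qᵢ₊₁`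
are not collinear for `i = 1, …, m-1`.  Then every kernel vector `mv` of the rigidity
matrix of the framework with path edges `{qᵢ, qᵢ₊₁}` (`i = 1, …, m-1`) and cone edges
`{q₀, qᵢ}` (`i = 1, …, m`) is a trivial infinitesimal motion
`mv v = a + b • (p v)ᵖᵉʳᵖ`; equivalently the rigidity matrix has rank `2(m+1) - 3`. -/
theorem triangle_string_infinitesimally_rigid (m : ℕ) (hm : 2 ≤ m)
    (p : Fin (m + 1) → ℝ × ℝ)
    (hcol : ∀ i : ℕ, (h1 : 1 ≤ i) → (h2 : i + 1 ≤ m) →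
      ¬ Collinear ℝ ({p ⟨0, by omega⟩, p ⟨i, by omega⟩, p ⟨i + 1, by omega⟩} :
        Set (ℝ × ℝ)))
    (mv : Fin (m + 1) → ℝ × ℝ)
    (hpath : ∀ i : ℕ, (h1 : 1 ≤ i) → (h2 : i + 1 ≤ m) →
      dot (p ⟨i, by omega⟩ - p ⟨i + 1, by omega⟩)
        (mv ⟨i, by omega⟩ - mv ⟨i + 1, by omega⟩) = 0)
    (hcone : ∀ i : ℕ, (h1 : 1 ≤ i) → (h2 : i ≤ m) →
      dot (p ⟨0, by omega⟩ - p ⟨i, by omega⟩)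
        (mv ⟨0, by omega⟩ - mv ⟨i, by omega⟩) = 0) :
    ∃ (a : ℝ × ℝ) (b : ℝ), ∀ v : Fin (m + 1), mv v = a + b • perp (p v) := by
  have hne : p ⟨1, by omega⟩ ≠ p ⟨0, by omega⟩ := by
    intro h
    refine hcol 1 le_rfl hm (collinear_of_det_eq_zero _ _ _ ?_)
    rw [h]; ring
  obtain ⟨b, hb⟩ := exists_rotation _ _ _ _ hne (hcone 1 le_rfl (by omega))
  have key : ∀ i : ℕ, 1 ≤ i → ∀ h2 : i ≤ m, mv ⟨i, by omega⟩ =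
      mv ⟨0, by omega⟩ + b • perp (p ⟨i, by omega⟩ - p ⟨0, by omega⟩) := by
    intro i h1
    induction i, h1 using Nat.le_induction with
    | base => intro _; exact hb
    | succ i h1 ih =>
      intro h2
      exact rotation_step _ _ _ _ _ _ b (hcol i h1 h2) (ih (by omega)) (hpath i h1 h2)
        (hcone (i + 1) (by omega) h2)
  refine ⟨mv ⟨0, by omega⟩ - b • perp (p ⟨0, by omega⟩), b, ?_⟩
  rintro ⟨v, hv⟩
  rcases Nat.eq_zero_or_pos v with rfl | hpos
  · simp
  · rw [key v hpos (by omega)]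
    refine Prod.ext ?_ ?_
    · simp only [perp, Prod.fst_add, Prod.fst_sub, Prod.smul_fst, Prod.snd_sub, smul_eq_mul]
      ring
    · simp only [perp, Prod.snd_add, Prod.snd_sub, Prod.smul_snd, Prod.fst_sub, smul_eq_mul]
      ring
end
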